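/- arXiv:1108.5578 — 4 statements merged into one kernel-verified Lean document; each statement's English description precedes it below -/
import Mathlib

section
/- There exists a compact set K ⊆ ℝ² which is an attractor of an iterated function system (i.e. K is nonempty and there are finitely many contractions Ψ₁, …, Ψ_m : K → K with K = Ψ₁(K) ∪ … ∪ Ψ_m(K)) such that the generic f ∈ C(K) has a unique level set of Hausdorff dimension dim_tH K − 1: for the generic f ∈ C(K) there is exactly one y ∈ ℝ with dim_H f⁻¹(y) = dim_tH K − 1. -/
open MeasureTheory Topology Metric Set
open scoped Classical

/-- Hausdorff dimension of a subset of a metric space, as an extended real number, with the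
convention that the empty set has dimension `-1`. -/
noncomputable def hdim {X : Type*} [EMetricSpace X] (s : Set X) : EReal :=
  if s = ∅ then -1 else (dimH s : EReal)

/-- The topological Hausdorff dimension of a metric space `X`:
`dim_tH X = inf {d : X has a basis 𝒰 such that dim_H ∂U ≤ d − 1 for every U ∈ 𝒰}`, with the
convention `dim_tH ∅ = -1` (the infimum of the empty set of extended reals being `⊤`). -/
noncomputable def tHdim (X : Type*) [MetricSpace X] : EReal :=
  if Nonempty X then
    sInf {d : EReal | ∃ 𝒰 : Set (Set X), TopologicalSpace.IsTopologicalBasis 𝒰 ∧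
      ∀ U ∈ 𝒰, hdim (frontier U) ≤ d - 1}
  else -1

/-! ### Power series with bounded digits -/

/-- The sum of the power series with coefficients `a` at `ρ`. -/
noncomputable def digitSum (ρ : ℝ) (a : ℕ → ℕ) : ℝ := ∑' n, (a n : ℝ) * ρ ^ n

section digitSum

variable {ρ : ℝ} {B : ℕ} {a b : ℕ → ℕ}

lemma summable_digitSum (h0 : 0 ≤ ρ) (h1 : ρ < 1) (ha : ∀ n, a n ≤ B) :
    Summable fun n => (a n : ℝ) * ρ ^ n := by
  refine Summable.of_nonneg_of_le (fun n => by positivity) (fun n => ?_)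
    ((summable_geometric_of_lt_one h0 h1).mul_left (B : ℝ))
  gcongr
  exact ha n

lemma digitSum_nonneg (h0 : 0 ≤ ρ) : 0 ≤ digitSum ρ a :=
  tsum_nonneg fun n => by positivity

lemma digitSum_le (h0 : 0 ≤ ρ) (h1 : ρ < 1) (ha : ∀ n, a n ≤ B) :
    digitSum ρ a ≤ B / (1 - ρ) := by
  rw [div_eq_mul_inv, ← tsum_geometric_of_lt_one h0 h1, ← tsum_mul_left]
  refine (summable_digitSum h0 h1 ha).tsum_le_tsum (fun n => ?_)
    ((summable_geometric_of_lt_one h0 h1).mul_left (B : ℝ))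
  gcongr
  exact ha n

lemma digitSum_eq_head_add (h0 : 0 ≤ ρ) (h1 : ρ < 1) (ha : ∀ n, a n ≤ B) :
    digitSum ρ a = a 0 + ρ * digitSum ρ (fun n => a (n + 1)) := by
  unfold digitSum
  rw [(summable_digitSum h0 h1 ha).tsum_eq_zero_add, ← tsum_mul_left]
  simp only [pow_zero, mul_one, pow_succ]
  congr 2
  ext n
  ring

lemma abs_digitSum_sub_le (h0 : 0 ≤ ρ) (h1 : ρ < 1) (n : ℕ) (ha : ∀ n, a n ≤ B)
    (hb : ∀ n, b n ≤ B) (h : ∀ i < n, a i = b i) :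
    |digitSum ρ a - digitSum ρ b| ≤ B / (1 - ρ) * ρ ^ n := by
  induction n generalizing a b with
  | zero =>
    have := digitSum_nonneg (a := a) h0
    have := digitSum_nonneg (a := b) h0
    have := digitSum_le h0 h1 ha
    have := digitSum_le h0 h1 hb
    rw [pow_zero, mul_one, abs_le]
    constructor <;> linarith
  | succ n ih =>
    rw [digitSum_eq_head_add h0 h1 ha, digitSum_eq_head_add h0 h1 hb, h 0 (by omega)]
    have := ih (fun i => ha (i + 1)) (fun i => hb (i + 1)) (fun i hi => h (i + 1) (by omega))
    rw [add_sub_add_left_eq_sub, ← mul_sub, abs_mul, abs_of_nonneg h0, pow_succ]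
    nlinarith

lemma le_abs_digitSum_sub (h0 : 0 ≤ ρ) (h1 : ρ < 1) (n : ℕ) (ha : ∀ n, a n ≤ B)
    (hb : ∀ n, b n ≤ B) (h : ∀ i < n, a i = b i) (hn : a n ≠ b n) :
    (1 - B * ρ / (1 - ρ)) * ρ ^ n ≤ |digitSum ρ a - digitSum ρ b| := by
  induction n generalizing a b with
  | zero =>
    rw [digitSum_eq_head_add h0 h1 ha, digitSum_eq_head_add h0 h1 hb, pow_zero, mul_one]
    have h2 := abs_digitSum_sub_le h0 h1 0 (fun i => ha (i + 1)) (fun i => hb (i + 1)) (by simp)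
    rw [pow_zero, mul_one] at h2
    have h3 : (1 : ℝ) ≤ |(a 0 : ℝ) - b 0| := by
      have : (1 : ℤ) ≤ |(a 0 : ℤ) - b 0| := Int.one_le_abs (by omega)
      exact_mod_cast this
    set x := digitSum ρ fun n => a (n + 1)
    set y := digitSum ρ fun n => b (n + 1)
    have h4 : |(a 0 : ℝ) - b 0| ≤ |(a 0 + ρ * x) - (b 0 + ρ * y)| + ρ * |x - y| := by
      rw [← abs_of_nonneg h0, ← abs_mul, abs_of_nonneg h0]
      calc _ = |((a 0 + ρ * x) - (b 0 + ρ * y)) - ρ * (x - y)| := by ring_nf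
        _ ≤ _ := abs_sub _ _
    have h5 : ρ * |x - y| ≤ ρ * (B / (1 - ρ)) := by gcongr
    have h6 : B * ρ / (1 - ρ) = ρ * (B / (1 - ρ)) := by ring
    linarith
  | succ n ih =>
    rw [digitSum_eq_head_add h0 h1 ha, digitSum_eq_head_add h0 h1 hb, h 0 (by omega)]
    have := ih (fun i => ha (i + 1)) (fun i => hb (i + 1)) (fun i hi => h (i + 1) (by omega)) hn
    rw [add_sub_add_left_eq_sub, ← mul_sub, abs_mul, abs_of_nonneg h0, pow_succ]
    nlinarith

end digitSum

lemma exists_first_difference {A : Type*} {a b : ℕ → A} (h : a ≠ b) :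
    ∃ n, (∀ i < n, a i = b i) ∧ a n ≠ b n := by
  have h' : ∃ n, a n ≠ b n := Function.ne_iff.1 h
  exact ⟨Nat.find h', fun i hi => not_not.1 (Nat.find_min h' hi), Nat.find_spec h'⟩

lemma exists_digitSum_eq {b : ℕ} (hb : 1 < b) {x : ℝ} (hx : x ∈ Icc (0 : ℝ) 1) :
    ∃ d : ℕ → Fin b, digitSum (1 / b) (fun n => d n) / b = x := by
  obtain ⟨d, -, rfl⟩ := Real.ofDigits_SurjOn hb hx
  refine ⟨d, ?_⟩
  rw [digitSum, Real.ofDigits, ← tsum_div_const]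
  congr 1
  ext n
  have hb0 : (b : ℝ) ≠ 0 := by positivity
  simp only [Real.ofDigitsTerm, pow_succ, mul_inv, div_eq_mul_inv]
  ring

lemma continuous_of_forall_exists_agree {A X : Type*} [TopologicalSpace A] [DiscreteTopology A]
    [PseudoMetricSpace X] {F : (ℕ → A) → X}
    (h : ∀ ε > 0, ∃ n, ∀ a b : ℕ → A, (∀ i < n, a i = b i) → dist (F a) (F b) < ε) :
    Continuous F := by
  refine continuous_iff_continuousAt.2 fun a => Metric.tendsto_nhds.2 fun ε hε => ?_
  obtain ⟨n, hn⟩ := h ε hε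
  have : ∀ᶠ b in 𝓝 a, ∀ i ∈ Finset.range n, b i = a i := by
    rw [Filter.eventually_all_finset]
    intro i _
    exact ((continuous_apply i).tendsto a).eventually
      (show ∀ᶠ x in 𝓝 (a i), x = a i by simp [nhds_discrete])
  filter_upwards [this] with b hb
  exact hn b a fun i hi => hb i (Finset.mem_range.2 hi)

lemma continuous_of_dist_le_pow {A X : Type*} [TopologicalSpace A] [DiscreteTopology A]
    [PseudoMetricSpace X] {F : (ℕ → A) → X} {c ρ : ℝ} (h0 : 0 ≤ ρ) (h1 : ρ < 1)
    (h : ∀ n, ∀ a b : ℕ → A, (∀ i < n, a i = b i) → dist (F a) (F b) ≤ c * ρ ^ n) :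
    Continuous F := by
  refine continuous_of_forall_exists_agree fun ε hε => ?_
  have : Filter.Tendsto (fun n => c * ρ ^ n) Filter.atTop (𝓝 (c * 0)) :=
    (tendsto_pow_atTop_nhds_zero_of_lt_one h0 h1).const_mul c
  rw [mul_zero] at this
  obtain ⟨n, hn⟩ := (this.eventually (gt_mem_nhds hε)).exists
  exact ⟨n, fun a b hab => (h n a b hab).trans_lt hn⟩

/-! ### Hausdorff dimensions of Cantor sets -/

lemma dimH_image_le_of_dist_le {ι X Y : Type*} [MetricSpace X] [MetricSpace Y] {a : ι → X}
    {b : ι → Y} {s : Set ι} {C : ℝ} {r : NNReal} (hr : 0 < r)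
    (h : ∀ i ∈ s, ∀ j ∈ s, dist (b i) (b j) ≤ C * dist (a i) (a j) ^ (r : ℝ)) :
    dimH (b '' s) ≤ dimH (a '' s) / r := by
  rcases s.eq_empty_or_nonempty with rfl | ⟨i₀, hi₀⟩
  · simp
  have : Nonempty ι := ⟨i₀⟩
  have hinv : ∀ x ∈ a '' s, Function.invFunOn a s x ∈ s ∧ a (Function.invFunOn a s x) = x :=
    fun x hx => ⟨Function.invFunOn_mem hx, Function.invFunOn_eq hx⟩
  have hH : HolderOnWith C.toNNReal r (fun x => b (Function.invFunOn a s x)) (a '' s) := by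
    intro x hx y hy
    obtain ⟨hx1, hx2⟩ := hinv x hx
    obtain ⟨hy1, hy2⟩ := hinv y hy
    have := h _ hx1 _ hy1
    rw [hx2, hy2] at this
    rw [edist_dist, edist_dist, ENNReal.ofReal_rpow_of_nonneg dist_nonneg r.coe_nonneg]
    change _ ≤ ENNReal.ofReal C * _
    rw [← ENNReal.ofReal_mul' (by positivity)]
    exact ENNReal.ofReal_le_ofReal this
  have heq : b '' s = (fun x => b (Function.invFunOn a s x)) '' (a '' s) := by
    rw [image_image]
    refine image_congr fun i hi => ?_
    obtain ⟨h1, h2⟩ := hinv (a i) (mem_image_of_mem a hi)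
    have h3 := h _ hi _ h1
    rw [h2, dist_self, Real.zero_rpow (by exact_mod_cast hr.ne'), mul_zero] at h3
    exact dist_le_zero.1 h3
  rw [heq]
  exact hH.dimH_image_le hr

lemma dimH_range_le_of_dist_le {ι X Y : Type*} [MetricSpace X] [MetricSpace Y] {a : ι → X}
    {b : ι → Y} {C : ℝ} {r : NNReal} (hr : 0 < r)
    (h : ∀ i j, dist (b i) (b j) ≤ C * dist (a i) (a j) ^ (r : ℝ)) :
    dimH (range b) ≤ dimH (range a) / r := by
  simpa only [image_univ] using
    dimH_image_le_of_dist_le (s := univ) hr fun i _ j _ => h i j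

lemma dimH_range_le_of_dist_le_mul {ι X Y : Type*} [MetricSpace X] [MetricSpace Y] {a : ι → X}
    {b : ι → Y} (C : ℝ) (h : ∀ i j, dist (b i) (b j) ≤ C * dist (a i) (a j)) :
    dimH (range b) ≤ dimH (range a) := by
  simpa using dimH_range_le_of_dist_le (a := a) (b := b) (C := C) one_pos (by simpa using h)

/-- The sum of a power series with coefficients in `{0, 1}`. -/
noncomputable def bitSum (ρ : ℝ) (c : ℕ → Bool) : ℝ := digitSum ρ fun n => (c n).toNat

lemma bitSum_nonneg {ρ : ℝ} (h0 : 0 ≤ ρ) (c : ℕ → Bool) : 0 ≤ bitSum ρ c := digitSum_nonneg h0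

lemma bitSum_le {ρ : ℝ} (h0 : 0 ≤ ρ) (h1 : ρ < 1) (c : ℕ → Bool) :
    bitSum ρ c ≤ 1 / (1 - ρ) := by
  simpa [bitSum] using digitSum_le (B := 1) h0 h1 fun n => (c n).toNat_le

lemma abs_bitSum_sub_le {ρ : ℝ} (h0 : 0 ≤ ρ) (h1 : ρ < 1) (n : ℕ) {c c' : ℕ → Bool}
    (h : ∀ i < n, c i = c' i) : |bitSum ρ c - bitSum ρ c'| ≤ 1 / (1 - ρ) * ρ ^ n := by
  simpa [bitSum] using abs_digitSum_sub_le (B := 1) h0 h1 n (fun n => (c n).toNat_le)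
    (fun n => (c' n).toNat_le) fun i hi => by rw [h i hi]

lemma le_abs_bitSum_sub {ρ : ℝ} (h0 : 0 ≤ ρ) (h1 : ρ ≤ 1 / 3) (n : ℕ) {c c' : ℕ → Bool}
    (h : ∀ i < n, c i = c' i) (hn : c n ≠ c' n) :
    ρ ^ n / 2 ≤ |bitSum ρ c - bitSum ρ c'| := by
  have := le_abs_digitSum_sub (B := 1) h0 (by linarith) n (fun n => (c n).toNat_le)
    (fun n => (c' n).toNat_le) (fun i hi => by rw [h i hi])
    (fun h => hn (by revert h; cases c n <;> cases c' n <;> simp))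
  refine le_trans ?_ this
  have h2 : 1 * ρ / (1 - ρ) ≤ 1 / 2 := by
    rw [div_le_iff₀ (by linarith)]
    linarith
  have h3 : 0 ≤ ρ ^ n := by positivity
  push_cast
  nlinarith

lemma abs_bitSum_sub_le_rpow {ρ σ r : ℝ} (h0 : 0 < ρ) (h1 : ρ ≤ 1 / 3) (hr : 0 ≤ r)
    (hσ : σ = ρ ^ r) (hσ' : σ ≤ 1 / 2) (c c' : ℕ → Bool) :
    |bitSum σ c - bitSum σ c'| ≤ 2 * 2 ^ r * |bitSum ρ c - bitSum ρ c'| ^ r := by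
  by_cases hc : c = c'
  · subst hc
    simp only [sub_self, abs_zero]
    positivity
  obtain ⟨n, h, hn⟩ := exists_first_difference hc
  have hσ0 : 0 ≤ σ := by rw [hσ]; positivity
  calc |bitSum σ c - bitSum σ c'| ≤ 1 / (1 - σ) * σ ^ n :=
        abs_bitSum_sub_le hσ0 (by linarith) n h
    _ ≤ 2 * σ ^ n := by
        gcongr
        rw [div_le_iff₀ (by linarith)]
        linarith
    _ = 2 * (2 ^ r * (ρ ^ n / 2) ^ r) := by
        rw [← Real.mul_rpow (by norm_num) (by positivity), mul_div_cancel₀ _ (by norm_num), hσ,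
          ← Real.rpow_natCast, ← Real.rpow_natCast, ← Real.rpow_mul h0.le, ← Real.rpow_mul h0.le,
          mul_comm r]
    _ ≤ 2 * (2 ^ r * |bitSum ρ c - bitSum ρ c'| ^ r) := by
        gcongr
        exact le_abs_bitSum_sub h0.le h1 n h hn
    _ = _ := by ring

lemma dimH_range_bitSum_le {ρ σ : ℝ} {r : NNReal} (h0 : 0 < ρ) (h1 : ρ ≤ 1 / 3) (hr : 0 < r)
    (hσ : σ = ρ ^ (r : ℝ)) (hσ' : σ ≤ 1 / 2) :
    dimH (range (bitSum σ)) ≤ dimH (range (bitSum ρ)) / r :=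
  dimH_range_le_of_dist_le hr (abs_bitSum_sub_le_rpow h0 h1 r.2 hσ hσ')

/-- The Hausdorff dimension of the set of numbers with base `4` digits in `{0, 1}`. -/
noncomputable def baseDim : ENNReal := dimH (range (bitSum (1 / 4)))

lemma baseDim_lt_one : baseDim < 1 := by
  have h4 : ((1 / 4 : ℝ) ^ (4 / 5 : ℝ)) ≤ 1 / 3 := by
    have : ((1 / 4 : ℝ) ^ (4 / 5 : ℝ)) ^ 5 ≤ (1 / 3) ^ 5 := by
      rw [← Real.rpow_natCast, ← Real.rpow_mul (by norm_num)]
      norm_num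
    exact le_of_pow_le_pow_left₀ (by norm_num) (by norm_num) this
  have h := dimH_range_bitSum_le (ρ := (1 / 4 : ℝ) ^ (4 / 5 : ℝ)) (σ := 1 / 4) (r := 5 / 4)
    (by positivity) h4 (by norm_num)
    (by rw [← Real.rpow_mul (by norm_num)]; norm_num) (by norm_num)
  have h1 : dimH (range (bitSum ((1 / 4 : ℝ) ^ (4 / 5 : ℝ)))) ≤ 1 :=
    (dimH_mono (subset_univ _)).trans Real.dimH_univ.le
  refine lt_of_le_of_lt (h.trans (ENNReal.div_le_div_right h1 _)) ?_
  rw [ENNReal.div_lt_iff (by norm_num) (by norm_num), one_mul]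
  norm_cast
  rw [← NNReal.coe_lt_coe]
  norm_num

lemma baseDim_pos : 0 < baseDim := by
  have h := dimH_range_bitSum_le (ρ := 1 / 4) (σ := 1 / 2) (r := 1 / 2)
    (by norm_num) (by norm_num) (by norm_num)
    (by
      rw [show (1 / 4 : ℝ) = (1 / 2) ^ (2 : ℝ) by norm_num, ← Real.rpow_mul (by norm_num)]
      norm_num)
    (by norm_num)
  have h1 : 1 ≤ dimH (range (bitSum (1 / 2))) := by
    have : Icc (0 : ℝ) 1 ⊆ (range (bitSum (1 / 2))) := by
      intro x hx
      obtain ⟨d, hd⟩ := exists_digitSum_eq (b := 2) (by norm_num)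
        (x := x / 2) ⟨by linarith [hx.1], by linarith [hx.2]⟩
      refine ⟨fun n => d n = 1, ?_⟩
      have h2 : digitSum (1 / 2) (fun n => d n) = x := by
        push_cast at hd
        linarith
      rw [← h2, bitSum]
      congr 1
      ext n
      generalize d n = k
      fin_cases k <;> simp
    refine le_trans ?_ (dimH_mono this)
    rw [Real.dimH_of_nonempty_interior (by simp)]
    simp
  rw [pos_iff_ne_zero]
  intro h0
  rw [← baseDim, h0] at h
  simp at h
  simp [h] at h1

/-- A sequence of exponents decreasing to `1`. -/
noncomputable def expo (m : ℕ) : NNReal := (m + 2) / (m + 1)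

/-- A sequence of ratios increasing to `1 / 4`. -/
noncomputable def ratio (m : ℕ) : ℝ := (1 / 4 : ℝ) ^ (expo m : ℝ)

/-- The Hausdorff dimension of `range (bitSum (ratio m))`. -/
noncomputable def pieceDim (m : ℕ) : ENNReal := baseDim / expo m

lemma one_lt_expo (m : ℕ) : 1 < expo m := by
  rw [expo, one_lt_div (by positivity)]
  gcongr
  norm_num

lemma ratio_pos (m : ℕ) : 0 < ratio m := by unfold ratio; positivity

lemma ratio_le (m : ℕ) : ratio m ≤ 1 / 4 := by
  have : ratio m ≤ (1 / 4 : ℝ) ^ (1 : ℝ) :=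
    Real.rpow_le_rpow_of_exponent_ge (by norm_num) (by norm_num)
      (by exact_mod_cast (one_lt_expo m).le)
  simpa using this

lemma dimH_range_bitSum_ratio (m : ℕ) : dimH (range (bitSum (ratio m))) = pieceDim m := by
  have h0 : 0 < expo m := zero_lt_one.trans (one_lt_expo m)
  refine le_antisymm (dimH_range_bitSum_le (by norm_num) (by norm_num) h0 rfl
    ((ratio_le m).trans (by norm_num))) ?_
  have h := dimH_range_bitSum_le (ρ := ratio m) (σ := 1 / 4) (r := (expo m)⁻¹) (ratio_pos m)
    ((ratio_le m).trans (by norm_num)) (by positivity)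
    (by
      rw [ratio, ← Real.rpow_mul (by norm_num), NNReal.coe_inv,
        mul_inv_cancel₀ (by exact_mod_cast h0.ne'), Real.rpow_one]) (by norm_num)
  rw [pieceDim]
  refine ENNReal.div_le_of_le_mul (h.trans (le_of_eq ?_))
  rw [ENNReal.coe_inv h0.ne', div_eq_mul_inv, inv_inv]

lemma pieceDim_lt (m : ℕ) : pieceDim m < baseDim := by
  rw [pieceDim, ENNReal.div_lt_iff (by simp [(zero_lt_one.trans (one_lt_expo m)).ne']) (by simp)]
  conv_lhs => rw [← mul_one baseDim]
  rw [ENNReal.mul_lt_mul_iff_right baseDim_pos.ne' (baseDim_lt_one.trans ENNReal.one_lt_top).ne]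
  exact_mod_cast one_lt_expo m

lemma pieceDim_mono : Monotone pieceDim := by
  intro m n hmn
  refine ENNReal.div_le_div_left ?_ _
  norm_cast
  rw [expo, expo, div_le_div_iff₀ (by positivity) (by positivity)]
  norm_cast
  nlinarith

lemma baseDim_le_of_forall {x : ENNReal} (h : ∀ m, pieceDim m ≤ x) : baseDim ≤ x := by
  have h1 : Filter.Tendsto (fun m => (expo m : ENNReal)) Filter.atTop (𝓝 1) := by
    rw [← ENNReal.coe_one, ENNReal.tendsto_coe, ← NNReal.tendsto_coe]
    have : (fun m => ((expo m : NNReal) : ℝ)) = fun m : ℕ => 1 + 1 / ((m : ℝ) + 1) := by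
      ext m
      simp only [expo]
      push_cast
      field_simp
      ring
    rw [this]
    simpa using tendsto_one_div_add_atTop_nhds_zero_nat.const_add (1 : ℝ)
  have h2 : Filter.Tendsto pieceDim Filter.atTop (𝓝 (baseDim / 1)) :=
    ENNReal.Tendsto.const_div h1 (Or.inl ENNReal.one_ne_top)
  rw [div_one] at h2
  exact le_of_tendsto' h2 h

/-! ### Open covers and Hausdorff measure -/

/-- `s` has a countable cover by open sets such that the sum of the `t`-th powers of the diameters
is at most `ε`. -/
def HasSmallOpenCover {X : Type*} [MetricSpace X] (t : NNReal) (ε : ENNReal) (s : Set X) : Prop :=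
  ∃ U : ℕ → Set X, (∀ n, IsOpen (U n)) ∧ s ⊆ ⋃ n, U n ∧ ∑' n, ediam (U n) ^ (t : ℝ) ≤ ε

section HasSmallOpenCover

variable {X : Type*} [MetricSpace X] {t : NNReal} {s : Set X}

lemma exists_isOpen_superset_ediam_rpow_le (s : Set X) (ht : 0 < t) {ε : ENNReal} (hε : 0 < ε) :
    ∃ V, IsOpen V ∧ s ⊆ V ∧ ediam V ^ (t : ℝ) ≤ (⨆ _ : s.Nonempty, ediam s ^ (t : ℝ)) + ε := by
  rcases s.eq_empty_or_nonempty with rfl | hs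
  · refine ⟨∅, isOpen_empty, Subset.rfl, ?_⟩
    have : (0 : ℝ) < t := ht
    simp [ENNReal.zero_rpow_of_pos this]
  rw [iSup_pos hs]
  by_cases htop : ediam s ^ (t : ℝ) = ⊤
  · exact ⟨univ, isOpen_univ, subset_univ _, by simp [htop]⟩
  have hc : Filter.Tendsto (fun δ : NNReal => (ediam s + 2 * (δ : ENNReal)) ^ (t : ℝ)) (𝓝[>] 0)
      (𝓝 (ediam s ^ (t : ℝ))) := by
    have h1 : Continuous fun δ : NNReal => (ediam s + 2 * (δ : ENNReal)) ^ (t : ℝ) :=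
      (ENNReal.continuous_rpow_const).comp
        (continuous_const.add
          ((ENNReal.continuous_const_mul (by simp)).comp ENNReal.continuous_coe))
    have h2 := h1.tendsto 0
    simp only [ENNReal.coe_zero, mul_zero, add_zero] at h2
    exact h2.mono_left nhdsWithin_le_nhds
  have hlt : ediam s ^ (t : ℝ) < ediam s ^ (t : ℝ) + ε := ENNReal.lt_add_right htop hε.ne'
  obtain ⟨δ, hδ, hδ0⟩ := ((hc.eventually (gt_mem_nhds hlt)).and self_mem_nhdsWithin).exists
  refine ⟨thickening δ s, isOpen_thickening, self_subset_thickening (by exact_mod_cast hδ0) _, ?_⟩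
  exact (ENNReal.rpow_le_rpow (ediam_thickening_le δ) t.2).trans hδ.le

lemma HasSmallOpenCover.of_hausdorffMeasure_eq_zero [MeasurableSpace X] [BorelSpace X]
    (ht : 0 < t) (h : μH[t] s = 0) {ε : ENNReal} (hε : 0 < ε) : HasSmallOpenCover t ε s := by
  rw [Measure.hausdorffMeasure_apply] at h
  simp only [ENNReal.iSup_eq_zero] at h
  have h1 := h 1 one_pos
  have hε2 : 0 < ε / 2 := ENNReal.half_pos hε.ne'
  rw [← h1] at hε2
  simp only [iInf_lt_iff] at hε2
  obtain ⟨T, hT, -, hsum⟩ := hε2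
  obtain ⟨e, he, hesum⟩ := ENNReal.exists_pos_sum_of_countable' (ENNReal.half_pos hε.ne').ne' ℕ
  choose V hVo hTV hV using fun n => exists_isOpen_superset_ediam_rpow_le (T n) ht (he n)
  refine ⟨V, hVo, hT.trans (iUnion_mono hTV), (ENNReal.tsum_le_tsum hV).trans ?_⟩
  rw [ENNReal.tsum_add, ← ENNReal.add_halves ε]
  exact add_le_add hsum.le hesum.le

lemma HasSmallOpenCover.mono {ε : ENNReal} {s' : Set X} (h : HasSmallOpenCover t ε s)
    (hs : s' ⊆ s) : HasSmallOpenCover t ε s' := by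
  obtain ⟨U, h1, h2, h3⟩ := h
  exact ⟨U, h1, hs.trans h2, h3⟩

lemma hausdorffMeasure_eq_zero_of_hasSmallOpenCover [MeasurableSpace X] [BorelSpace X]
    (ht : 0 < t) (h : ∀ k : ℕ, HasSmallOpenCover t (k + 1 : ENNReal)⁻¹ s) : μH[t] s = 0 := by
  have ht' : (0 : ℝ) < t := ht
  rw [Measure.hausdorffMeasure_apply]
  simp only [ENNReal.iSup_eq_zero]
  intro r hr
  refine le_antisymm (ENNReal.le_of_forall_pos_le_add fun ε hε _ => ?_) zero_le
  have hpos : (0 : ENNReal) < min (ε : ENNReal) (r ^ (t : ℝ)) :=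
    lt_min (by exact_mod_cast hε) (ENNReal.rpow_pos_of_nonneg hr ht'.le)
  obtain ⟨k, hk⟩ := ENNReal.exists_inv_nat_lt hpos.ne'
  obtain ⟨U, -, hsU, hU⟩ := h k
  have hk' : (k + 1 : ENNReal)⁻¹ ≤ min (ε : ENNReal) (r ^ (t : ℝ)) :=
    (ENNReal.inv_le_inv.2 le_self_add).trans hk.le
  refine iInf_le_of_le U (iInf_le_of_le hsU (iInf_le_of_le (fun n => ?_) ?_))
  · rw [← ENNReal.rpow_le_rpow_iff ht']
    exact (ENNReal.le_tsum n).trans (hU.trans (hk'.trans (min_le_right _ _)))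
  · rw [zero_add]
    refine le_trans (ENNReal.tsum_le_tsum fun n => ?_)
      (hU.trans (hk'.trans (min_le_left _ _)))
    exact iSup_le fun _ => le_rfl

end HasSmallOpenCover

/-! ### Upper bound for the level sets of the generic continuous function -/

lemma mem_residual_of_dense_interior {Y : Type*} [TopologicalSpace Y] {s : Set Y}
    (h : Dense (interior s)) : s ∈ residual Y :=
  Filter.mem_of_superset (residual_of_dense_open isOpen_interior h) interior_subset

section Generic

variable {X : Type*} [MetricSpace X]

lemma exists_forall_hasSmallOpenCover {g : C(X, ℝ)} {A : Set X} (hA : IsCompact A) {t : NNReal}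
    {ε : ENNReal} (h : ∀ y, HasSmallOpenCover t ε (g ⁻¹' {y} ∩ A)) :
    ∃ η > 0, ∀ y, HasSmallOpenCover t ε (g ⁻¹' (ball y η) ∩ A) := by
  have h1 : ∀ y, ∃ η > 0, HasSmallOpenCover t ε (g ⁻¹' (ball y (3 * η)) ∩ A) := by
    intro y
    obtain ⟨U, hUo, hsU, hU⟩ := h y
    have hc : IsCompact (g '' (A \ ⋃ n, U n)) :=
      (hA.diff (isOpen_iUnion hUo)).image g.continuous
    have hy : y ∉ g '' (A \ ⋃ n, U n) := by
      rintro ⟨x, ⟨hxA, hxU⟩, rfl⟩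
      exact hxU (hsU ⟨rfl, hxA⟩)
    obtain ⟨η, hη, hball⟩ := Metric.isOpen_iff.1 hc.isClosed.isOpen_compl y hy
    refine ⟨η / 3, by positivity, U, hUo, fun x hx => ?_, hU⟩
    by_contra hxU
    refine hball (?_ : g x ∈ ball y η) ⟨x, ⟨hx.2, hxU⟩, rfl⟩
    simpa [mul_div_cancel₀] using hx.1
  choose η hη hcov using h1
  obtain ⟨F, hF⟩ := (hA.image g.continuous).elim_finite_subcover (fun y => ball y (η y))
    (fun y => isOpen_ball) (fun y _ => mem_iUnion.2 ⟨y, mem_ball_self (hη y)⟩)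
  obtain ⟨η₀, hη₀, hmin⟩ : ∃ η₀ > 0, ∀ y ∈ F, η₀ ≤ η y := by
    rcases F.eq_empty_or_nonempty with rfl | hne
    · exact ⟨1, one_pos, by simp⟩
    · obtain ⟨y, -, hy⟩ := F.exists_min_image η hne
      exact ⟨η y, hη y, hy⟩
  refine ⟨η₀, hη₀, fun y => ?_⟩
  rcases (g ⁻¹' (ball y η₀) ∩ A).eq_empty_or_nonempty with he | ⟨x, hx, hxA⟩
  · rw [he]
    exact (h 0).mono (empty_subset _)
  obtain ⟨z, hz⟩ := mem_iUnion.1 (hF (mem_image_of_mem g hxA))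
  obtain ⟨hzF, hz⟩ := mem_iUnion.1 hz
  refine (hcov z).mono (inter_subset_inter_left _ (preimage_mono fun w hw => ?_))
  rw [mem_ball] at *
  rw [mem_preimage, mem_ball] at hx
  have h2 := hmin z hzF
  have h3 : dist w z ≤ dist w y + dist (g x) y + dist (g x) z := by
    rw [dist_comm (g x) y]
    linarith [dist_triangle w y z, dist_triangle y (g x) z]
  linarith

lemma residual_forall_dimH_le [CompactSpace X] {A : Set X} (hA : IsCompact A) {d : ENNReal}
    (hd : Dense {g : C(X, ℝ) | ∀ y, dimH (g ⁻¹' {y} ∩ A) ≤ d}) :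
    {f : C(X, ℝ) | ∀ y, dimH (f ⁻¹' {y} ∩ A) ≤ d} ∈ residual C(X, ℝ) := by
  borelize X
  have key : ∀ (q : ℚ) (k : ℕ), ∀ᶠ f : C(X, ℝ) in residual C(X, ℝ), d < Real.toNNReal q →
      ∀ y, HasSmallOpenCover (Real.toNNReal q) (k + 1 : ENNReal)⁻¹ (f ⁻¹' {y} ∩ A) := by
    intro q k
    by_cases hq : d < Real.toNNReal q
    swap
    · exact Filter.Eventually.of_forall fun f h => absurd h hq
    have hq0 : 0 < Real.toNNReal q := by exact_mod_cast (zero_le.trans_lt hq)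
    refine mem_residual_of_dense_interior (hd.mono fun g hg => ?_)
    obtain ⟨η, hη, h⟩ := exists_forall_hasSmallOpenCover (g := g) hA fun y =>
      HasSmallOpenCover.of_hausdorffMeasure_eq_zero hq0
        (hausdorffMeasure_of_dimH_lt ((hg y).trans_lt hq))
        (show (0 : ENNReal) < (k + 1 : ENNReal)⁻¹ by simp)
    refine mem_interior.2 ⟨ball g η, fun f hf _ y => (h y).mono ?_, isOpen_ball,
      mem_ball_self hη⟩
    refine inter_subset_inter_left _ fun x hx => ?_
    have hx' : f x = y := hx
    rw [mem_preimage, mem_ball, ← hx', dist_comm]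
    exact (ContinuousMap.dist_apply_le_dist x).trans_lt hf
  filter_upwards [eventually_countable_forall.2 fun q => eventually_countable_forall.2 (key q)]
    with f hf y
  refine le_of_forall_gt fun e he => ?_
  obtain ⟨q, -, hdq, hqe⟩ := ENNReal.lt_iff_exists_rat_btwn.1 he
  have hq0 : 0 < Real.toNNReal q := by exact_mod_cast (zero_le.trans_lt hdq)
  have h0 := hausdorffMeasure_eq_zero_of_hasSmallOpenCover hq0 fun k => hf q k hdq y
  exact (dimH_le_of_hausdorffMeasure_ne_top (by rw [h0]; simp)).trans_lt hqe

/-- Continuous functions which locally in `π` are polynomials in `w`. -/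
def localPolynomials (π w : C(X, ℝ)) : Subalgebra ℝ C(X, ℝ) where
  carrier := {g | ∀ p, ∃ I ∈ 𝓝 (π p), ∃ P : Polynomial ℝ, ∀ q, π q ∈ I → g q = P.eval (w q)}
  mul_mem' := by
    intro f g hf hg p
    obtain ⟨I, hI, P, hP⟩ := hf p
    obtain ⟨J, hJ, Q, hQ⟩ := hg p
    exact ⟨I ∩ J, Filter.inter_mem hI hJ, P * Q, fun q hq => by simp [hP q hq.1, hQ q hq.2]⟩
  add_mem' := by
    intro f g hf hg p
    obtain ⟨I, hI, P, hP⟩ := hf p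
    obtain ⟨J, hJ, Q, hQ⟩ := hg p
    exact ⟨I ∩ J, Filter.inter_mem hI hJ, P + Q, fun q hq => by simp [hP q hq.1, hQ q hq.2]⟩
  algebraMap_mem' r p := ⟨univ, Filter.univ_mem, Polynomial.C r, fun q _ => by simp⟩

lemma localPolynomials_separatesPoints {π w : C(X, ℝ)} (hπ : Dense (range π)ᶜ)
    (hinj : ∀ p q, π p = π q → w p = w q → p = q) :
    (localPolynomials π w).SeparatesPoints := by
  intro p q hpq
  by_cases hw : w p = w q
  swap
  · exact ⟨w, ⟨w, fun p => ⟨univ, Filter.univ_mem, Polynomial.X, fun q _ => by simp⟩, rfl⟩, hw⟩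
  have hne : π p ≠ π q := fun h => hpq (hinj p q h hw)
  obtain ⟨a, ha, hpa⟩ : ∃ a ∈ (range π)ᶜ, (π p < a) ≠ (π q < a) := by
    rcases hne.lt_or_gt with h | h
    · obtain ⟨a, ha, h1, h2⟩ := hπ.exists_between h
      exact ⟨a, ha, by simp [h1, h2.le]⟩
    · obtain ⟨a, ha, h1, h2⟩ := hπ.exists_between h
      exact ⟨a, ha, by simp [h1, h2.le]⟩
  have hcont : Continuous fun x : X => if π x < a then (1 : ℝ) else 0 := by
    refine continuous_if (fun x hx => ?_) continuous_const.continuousOn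
      continuous_const.continuousOn
    exact absurd (frontier_lt_subset_eq π.continuous continuous_const hx) fun h => ha ⟨x, h⟩
  refine ⟨_, ⟨⟨_, hcont⟩, fun x => ?_, rfl⟩, ?_⟩
  · rcases lt_or_gt_of_ne (fun h => ha ⟨x, h⟩ : π x ≠ a) with h | h
    · exact ⟨Iio a, Iio_mem_nhds h, 1, fun q hq => by
        have : π q < a := hq
        simp [this]⟩
    · exact ⟨Ioi a, Ioi_mem_nhds h, 0, fun q hq => by
        have : a < π q := hq
        simp [this.le]⟩
  · by_cases h1 : π p < a <;> by_cases h2 : π q < a <;> simp_all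

lemma dense_finite_level_image [CompactSpace X] {π w : C(X, ℝ)} (hπ : Dense (range π)ᶜ)
    (hinj : ∀ p q, π p = π q → w p = w q → p = q) :
    Dense {g : C(X, ℝ) | ∀ y, (w '' (g ⁻¹' {y})).Finite} := by
  refine Metric.dense_iff.2 fun f ε hε => ?_
  obtain ⟨⟨g, hg⟩, hgf⟩ := ContinuousMap.exists_mem_subalgebra_near_continuousMap_of_separatesPoints
    _ (localPolynomials_separatesPoints hπ hinj) f (ε / 2) (by positivity)
  have hg' := hg
  choose I hI P hP using hg'
  obtain ⟨F, hF⟩ := isCompact_univ.elim_nhds_subcover (fun p => π ⁻¹' (I p))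
    (fun p _ => π.continuous.continuousAt (hI p))
  have hlim : Filter.Tendsto (fun η : ℝ => ‖η • w‖) (𝓝[≠] 0) (𝓝 0) := by
    have : Continuous fun η : ℝ => ‖η • w‖ := by fun_prop
    simpa using (this.tendsto 0).mono_left nhdsWithin_le_nhds
  have hfin : ∀ᶠ η : ℝ in 𝓝[≠] 0, ∀ p ∈ F, (P p).coeff 1 + η ≠ 0 := by
    rw [Filter.eventually_all_finset]
    intro p _
    by_cases h0 : (P p).coeff 1 = 0
    · filter_upwards [self_mem_nhdsWithin] with η hη
      simpa [h0] using hη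
    · have : ∀ᶠ η : ℝ in 𝓝 0, (P p).coeff 1 + η ≠ 0 := by
        refine ContinuousAt.eventually_ne (by fun_prop) (by simpa using h0)
      exact this.filter_mono nhdsWithin_le_nhds
  obtain ⟨η, hη1, hη2⟩ := (hfin.and (hlim.eventually (gt_mem_nhds (half_pos hε)))).exists
  refine ⟨g + η • w, ?_, fun y => ?_⟩
  · rw [mem_ball, dist_eq_norm]
    calc ‖g + η • w - f‖ = ‖(g - f) + η • w‖ := by congr 1; abel
      _ ≤ ‖g - f‖ + ‖η • w‖ := norm_add_le _ _
      _ < ε := by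
        have : ‖g - f‖ < ε / 2 := hgf
        linarith
  · refine (F.finite_toSet.biUnion fun p hp => Polynomial.finite_setOfPred_isRoot (p :=
      P p + Polynomial.C η * Polynomial.X - Polynomial.C y) fun h0 => ?_).subset ?_
    · have h1 := congrArg (fun Q => Polynomial.coeff Q 1) h0
      simp [Polynomial.coeff_C] at h1
      exact hη1 p hp h1
    · rintro _ ⟨q, hq, rfl⟩
      obtain ⟨p, hp, hpq⟩ := mem_iUnion₂.1 (hF.2 (mem_univ q))
      refine mem_biUnion (Finset.mem_coe.2 hp) ?_
      have h1 : g q + η * w q = y := hq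
      have h2 := hP p q hpq
      simp [Polynomial.IsRoot, ← h2, h1]

lemma residual_forall_dimH_level_le [CompactSpace X] {π w : C(X, ℝ)} (hπ : Dense (range π)ᶜ)
    (hinj : ∀ p q, π p = π q → w p = w q → p = q) {A : Set X} (hA : IsCompact A) {d : ENNReal}
    (hw : ∀ b, dimH (w ⁻¹' {b} ∩ A) ≤ d) :
    {f : C(X, ℝ) | ∀ y, dimH (f ⁻¹' {y} ∩ A) ≤ d} ∈ residual C(X, ℝ) := by
  refine residual_forall_dimH_le hA ((dense_finite_level_image hπ hinj).mono fun g hg y => ?_)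
  have hsub : g ⁻¹' {y} ∩ A ⊆ ⋃ b ∈ w '' (g ⁻¹' {y}), w ⁻¹' {b} ∩ A := fun x hx =>
    mem_biUnion (mem_image_of_mem w hx.1) ⟨rfl, hx.2⟩
  refine (dimH_mono hsub).trans ?_
  rw [dimH_bUnion (hg y).countable]
  exact iSup₂_le fun b _ => hw b

end Generic

/-! ### Topological Hausdorff dimension -/

lemma hdim_of_nonempty {X : Type*} [EMetricSpace X] {s : Set X} (hs : s.Nonempty) :
    hdim s = (dimH s : EReal) := if_neg hs.ne_empty

lemma hdim_le {X : Type*} [EMetricSpace X] (s : Set X) : hdim s ≤ (dimH s : EReal) := by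
  unfold hdim
  split_ifs
  · exact le_trans (by norm_num) (EReal.coe_ennreal_nonneg _)
  · exact le_rfl

lemma isTopologicalBasis_dimH_frontier_le {X : Type*} [MetricSpace X] [CompactSpace X]
    {π w : C(X, ℝ)} (hπ : Dense (range π)ᶜ) (hinj : ∀ p q, π p = π q → w p = w q → p = q)
    {d : ENNReal} (hw : ∀ b, dimH (w ⁻¹' {b}) ≤ d) :
    TopologicalSpace.IsTopologicalBasis {U : Set X | IsOpen U ∧ dimH (frontier U) ≤ d} := by
  refine TopologicalSpace.isTopologicalBasis_of_isOpen_of_nhds (fun U hU => hU.1)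
    fun p V hp hV => ?_
  have hemb : IsEmbedding fun x => (π x, w x) :=
    ((by fun_prop : Continuous fun x => (π x, w x)).isClosedEmbedding fun x y h => by
      simp only [Prod.mk.injEq] at h
      exact hinj x y h.1 h.2).isEmbedding
  have hVn := hV.mem_nhds hp
  rw [hemb.isInducing.nhds_eq_comap, Filter.mem_comap] at hVn
  obtain ⟨W, hW, hWV⟩ := hVn
  obtain ⟨ε, hε, hεW⟩ := Metric.mem_nhds_iff.1 hW
  obtain ⟨a, ha, ha1, ha2⟩ := hπ.exists_between (show π p - ε < π p by linarith)
  obtain ⟨a', ha', ha'1, ha'2⟩ := hπ.exists_between (show π p < π p + ε by linarith)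
  refine ⟨π ⁻¹' Ioo a a' ∩ w ⁻¹' Ioo (w p - ε / 2) (w p + ε / 2), ⟨?_, ?_⟩, ?_, ?_⟩
  · exact (isOpen_Ioo.preimage π.continuous).inter (isOpen_Ioo.preimage w.continuous)
  · have hsub : frontier (π ⁻¹' Ioo a a' ∩ w ⁻¹' Ioo (w p - ε / 2) (w p + ε / 2)) ⊆
        w ⁻¹' {w p - ε / 2} ∪ w ⁻¹' {w p + ε / 2} := by
      have ho : IsOpen (π ⁻¹' Ioo a a' ∩ w ⁻¹' Ioo (w p - ε / 2) (w p + ε / 2)) :=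
        (isOpen_Ioo.preimage π.continuous).inter (isOpen_Ioo.preimage w.continuous)
      rw [ho.frontier_eq]
      rintro x ⟨hx1, hx2⟩
      have hx3 : x ∈ π ⁻¹' Icc a a' ∩ w ⁻¹' Icc (w p - ε / 2) (w p + ε / 2) :=
        closure_minimal (inter_subset_inter (preimage_mono Ioo_subset_Icc_self)
          (preimage_mono Ioo_subset_Icc_self))
          ((isClosed_Icc.preimage π.continuous).inter (isClosed_Icc.preimage w.continuous)) hx1
      obtain ⟨⟨h1, h2⟩, h3, h4⟩ := hx3
      have h1' := lt_of_le_of_ne h1 fun h => ha ⟨x, h.symm⟩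
      have h2' := lt_of_le_of_ne h2 fun h => ha' ⟨x, h⟩
      by_contra hx4
      simp only [mem_union, mem_preimage, mem_singleton_iff, not_or] at hx4
      exact hx2 ⟨⟨h1', h2'⟩, lt_of_le_of_ne h3 (Ne.symm hx4.1), lt_of_le_of_ne h4 hx4.2⟩
    refine (dimH_mono hsub).trans ?_
    rw [dimH_union]
    exact max_le (hw _) (hw _)
  · exact ⟨⟨ha2, ha'1⟩, by constructor <;> linarith⟩
  · rintro x ⟨⟨h1, h2⟩, h3, h4⟩
    refine hWV (hεW ?_)
    rw [mem_ball, Prod.dist_eq, max_lt_iff, Real.dist_eq, Real.dist_eq, abs_lt, abs_lt]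
    refine ⟨⟨?_, ?_⟩, ?_, ?_⟩ <;> dsimp only <;> linarith

lemma tHdim_le_of_dimH_level_le {X : Type*} [MetricSpace X] [CompactSpace X] [Nonempty X]
    {π w : C(X, ℝ)} (hπ : Dense (range π)ᶜ) (hinj : ∀ p q, π p = π q → w p = w q → p = q)
    {d : ENNReal} (hw : ∀ b, dimH (w ⁻¹' {b}) ≤ d) :
    tHdim X ≤ (d : EReal) + 1 := by
  rw [tHdim, if_pos ‹Nonempty X›]
  refine sInf_le ⟨_, isTopologicalBasis_dimH_frontier_le hπ hinj hw, fun U hU => ?_⟩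
  have : ((d : EReal) + 1) - 1 = d := EReal.add_sub_cancel_right (b := 1)
  rw [this]
  exact (hdim_le _).trans (EReal.coe_ennreal_le_coe_ennreal_iff.2 hU.2)

/-! ### The attractor -/

/-- Prepend a term to a sequence. -/
def consSeq {A : Type*} (a : A) (ω : ℕ → A) : ℕ → A
  | 0 => a
  | n + 1 => ω n

lemma consSeq_head_tail {A : Type*} (ω : ℕ → A) : consSeq (ω 0) (fun n => ω (n + 1)) = ω := by
  ext n
  cases n <;> rfl

/-- A parametrization of a Cantor set of dimension `pieceDim m` near `(1 / 4) ^ m`. -/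
noncomputable def pieceCoord (m : ℕ) (c : ℕ → Bool) : ℝ :=
  (1 / 4) ^ m * (1 + bitSum (ratio m) c / 4)

lemma bitSum_ratio_le (m : ℕ) (c : ℕ → Bool) : bitSum (ratio m) c ≤ 4 / 3 := by
  have h := ratio_le m
  refine (bitSum_le (ratio_pos m).le (by linarith) c).trans ?_
  rw [div_le_iff₀ (by linarith)]
  linarith

lemma le_pieceCoord (m : ℕ) (c : ℕ → Bool) : (1 / 4) ^ m ≤ pieceCoord m c := by
  have := bitSum_nonneg (ratio_pos m).le c
  exact le_mul_of_one_le_right (by positivity) (by linarith)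

lemma pieceCoord_le (m : ℕ) (c : ℕ → Bool) : pieceCoord m c ≤ 4 / 3 * (1 / 4) ^ m := by
  have := bitSum_ratio_le m c
  calc pieceCoord m c ≤ (1 / 4) ^ m * (4 / 3) :=
        mul_le_mul_of_nonneg_left (by linarith) (by positivity)
    _ = _ := mul_comm _ _

lemma abs_pieceCoord_sub_le (m n : ℕ) {c c' : ℕ → Bool} (h : ∀ i < n, c i = c' i) :
    |pieceCoord m c - pieceCoord m c'| ≤ 1 / 3 * (1 / 4) ^ (m + n) := by
  have hr := ratio_le m
  have hr0 := ratio_pos m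
  have h1 : |bitSum (ratio m) c - bitSum (ratio m) c'| ≤ 4 / 3 * (1 / 4) ^ n := by
    have h2 : 1 / (1 - ratio m) ≤ 4 / 3 := by
      rw [div_le_iff₀ (by linarith)]
      linarith
    refine (abs_bitSum_sub_le hr0.le (by linarith) n h).trans ?_
    gcongr
  have h2 : pieceCoord m c - pieceCoord m c' =
      (1 / 4) ^ m / 4 * (bitSum (ratio m) c - bitSum (ratio m) c') := by
    unfold pieceCoord
    ring
  rw [h2, abs_mul, abs_of_nonneg (by positivity), pow_add]
  calc _ ≤ (1 / 4 : ℝ) ^ m / 4 * (4 / 3 * (1 / 4) ^ n) := by gcongr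
    _ = _ := by ring

/-- A parametrization of `{0} ∪ ⋃ m, range (pieceCoord m)`. -/
noncomputable def coord (c : ℕ → Bool) : ℝ :=
  if h : ∃ n, c n then pieceCoord (Nat.find h) fun n => c (Nat.find h + 1 + n) else 0

lemma coord_eq_pieceCoord {c : ℕ → Bool} {m : ℕ} (hm : c m) (h : ∀ i < m, ¬ c i) :
    coord c = pieceCoord m fun n => c (m + 1 + n) := by
  have hex : ∃ n, c n := ⟨m, hm⟩
  have hf : Nat.find hex = m := (Nat.find_eq_iff hex).2 ⟨hm, h⟩
  rw [coord, dif_pos hex, hf]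

lemma coord_eq_zero {c : ℕ → Bool} (h : ¬ ∃ n, c n) : coord c = 0 := dif_neg h

lemma coord_nonneg (c : ℕ → Bool) : 0 ≤ coord c := by
  unfold coord
  split_ifs
  · exact le_trans (by positivity) (le_pieceCoord _ _)
  · exact le_rfl

lemma coord_le {c : ℕ → Bool} {n : ℕ} (h : ∀ i < n, ¬ c i) : coord c ≤ 4 / 3 * (1 / 4) ^ n := by
  unfold coord
  split_ifs with hex
  · refine (pieceCoord_le _ _).trans ?_
    have : n ≤ Nat.find hex := (Nat.le_find_iff hex n).2 h
    gcongr 4 / 3 * ?_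
    exact pow_le_pow_of_le_one (by norm_num) (by norm_num) this
  · positivity

lemma abs_coord_sub_le (n : ℕ) {c c' : ℕ → Bool} (h : ∀ i < n, c i = c' i) :
    |coord c - coord c'| ≤ 2 * (1 / 4) ^ n := by
  by_cases hex : ∃ i, i < n ∧ c i
  · obtain ⟨m, hm, hcm, hmin⟩ : ∃ m < n, c m ∧ ∀ i < m, ¬ c i := by
      obtain ⟨hm, hcm⟩ := Nat.find_spec hex
      exact ⟨_, hm, hcm, fun i hi hci => Nat.find_min hex hi ⟨hi.trans hm, hci⟩⟩
    rw [coord_eq_pieceCoord hcm hmin, coord_eq_pieceCoord (m := m) (by rwa [← h m hm])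
      fun i hi => by rw [← h i (hi.trans hm)]; exact hmin i hi]
    have h1 := abs_pieceCoord_sub_le m (n - (m + 1)) (c := fun n => c (m + 1 + n))
      (c' := fun n => c' (m + 1 + n)) fun i hi => h _ (by omega)
    refine h1.trans ?_
    obtain ⟨k, rfl⟩ := Nat.exists_eq_add_of_le (show m + 1 ≤ n from hm)
    rw [Nat.add_sub_cancel_left, show m + 1 + k = (m + k) + 1 by ring, pow_succ]
    have : (0 : ℝ) < (1 / 4) ^ (m + k) := by positivity
    linarith
  · push Not at hex
    have h1 := coord_le hex
    have h2 := coord_le (c := c') fun i hi => by rw [← h i hi]; exact hex i hi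
    have h3 := coord_nonneg c
    have h4 := coord_nonneg c'
    have : (0 : ℝ) < (1 / 4) ^ n := by positivity
    rw [abs_le]
    constructor <;> linarith

lemma exists_coord_eq_pieceCoord (m : ℕ) (c : ℕ → Bool) : ∃ c', coord c' = pieceCoord m c := by
  refine ⟨fun n => if n < m then false else if n = m then true else c (n - (m + 1)), ?_⟩
  rw [coord_eq_pieceCoord (m := m) (by simp) fun i hi => by simp [hi]]
  congr 1
  ext n
  have h1 : ¬ (m + 1 + n < m) := by omega
  have h2 : ¬ (m + 1 + n = m) := by omega
  simp [h1, h2]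

lemma coord_eq_zero_or (c : ℕ → Bool) : coord c = 0 ∨ ∃ m c', coord c = pieceCoord m c' := by
  unfold coord
  split_ifs
  · exact Or.inr ⟨_, _, rfl⟩
  · exact Or.inl rfl

/-- A surjection used to read a bit and a base `4` digit off a pair of ternary digits. -/
def splitDigit (p : Fin 3 × Fin 3) : Fin 4 × Bool :=
  (⟨(3 * p.1 + p.2) / 2 % 4, Nat.mod_lt _ (by norm_num)⟩, (3 * p.1 + p.2 : ℕ) % 2 = 1)

lemma splitDigit_surjective : Function.Surjective splitDigit := by
  unfold Function.Surjective
  decide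

/-- The height coordinate of `combPoint`, relative to the first coordinate. -/
noncomputable def heightFraction (ω : ℕ → Fin 3 × Fin 3) : ℝ :=
  digitSum (1 / 4) (fun n => (splitDigit (ω n)).1) / 4

/-- A parametrization of the triangular comb
`{(x, y) | x ∈ range coord, 0 ≤ y ≤ x}`. -/
noncomputable def combPoint (ω : ℕ → Fin 3 × Fin 3) : ℝ × ℝ :=
  (coord fun n => (splitDigit (ω n)).2, (coord fun n => (splitDigit (ω n)).2) * heightFraction ω)

lemma splitDigit_fst_le (ω : ℕ → Fin 3 × Fin 3) (n : ℕ) : ((splitDigit (ω n)).1 : ℕ) ≤ 3 := by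
  omega

lemma heightFraction_mem (ω : ℕ → Fin 3 × Fin 3) : heightFraction ω ∈ Icc (0 : ℝ) 1 := by
  have h0 := digitSum_nonneg (ρ := 1 / 4) (a := fun n => (splitDigit (ω n)).1) (by norm_num)
  have h1 := digitSum_le (ρ := 1 / 4) (by norm_num) (by norm_num) (splitDigit_fst_le ω)
  norm_num at h1
  constructor <;> unfold heightFraction <;> norm_num <;> linarith

lemma abs_heightFraction_sub_le (n : ℕ) {ω ω' : ℕ → Fin 3 × Fin 3} (h : ∀ i < n, ω i = ω' i) :
    |heightFraction ω - heightFraction ω'| ≤ (1 / 4) ^ n := by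
  have h1 := abs_digitSum_sub_le (ρ := 1 / 4) (by norm_num) (by norm_num) n (splitDigit_fst_le ω)
    (splitDigit_fst_le ω') fun i hi => by rw [h i hi]
  rw [heightFraction, heightFraction, ← sub_div, abs_div, abs_of_pos (by norm_num : (0 : ℝ) < 4),
    div_le_iff₀ (by norm_num)]
  refine h1.trans (le_of_eq ?_)
  norm_num
  ring

lemma dist_combPoint_le (n : ℕ) {ω ω' : ℕ → Fin 3 × Fin 3} (h : ∀ i < n, ω i = ω' i) :
    dist (combPoint ω) (combPoint ω') ≤ 4 * (1 / 4) ^ n := by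
  have h1 := abs_heightFraction_sub_le n h
  obtain ⟨h2, h3⟩ := heightFraction_mem ω
  have h4 := abs_coord_sub_le n (c := fun n => (splitDigit (ω n)).2)
    (c' := fun n => (splitDigit (ω' n)).2) fun i hi => by rw [h i hi]
  rw [Prod.dist_eq, Real.dist_eq, Real.dist_eq]
  simp only [combPoint]
  set x := coord fun n => (splitDigit (ω n)).2
  have h5 := coord_nonneg fun n => (splitDigit (ω' n)).2
  have h6 := coord_le (c := fun n => (splitDigit (ω' n)).2) (n := 0) (by simp)
  set x' := coord fun n => (splitDigit (ω' n)).2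
  set t := heightFraction ω
  set t' := heightFraction ω'
  have h7 : (0 : ℝ) < (1 / 4) ^ n := by positivity
  refine max_le (by linarith) ?_
  calc |x * t - x' * t'| = |(x - x') * t + x' * (t - t')| := by ring_nf
    _ ≤ |x - x'| * t + x' * |t - t'| := by
      refine (abs_add_le _ _).trans (le_of_eq ?_)
      rw [abs_mul, abs_mul, abs_of_nonneg h2, abs_of_nonneg h5]
    _ ≤ (2 * (1 / 4) ^ n) * 1 + 2 * (1 / 4) ^ n := by
      gcongr
      linarith
    _ = _ := by ring

lemma exists_combPoint_eq (c : ℕ → Bool) {t : ℝ} (ht : t ∈ Icc (0 : ℝ) 1) :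
    ∃ ω, combPoint ω = (coord c, coord c * t) := by
  obtain ⟨d, hd⟩ := exists_digitSum_eq (b := 4) (by norm_num) ht
  choose ω hω using fun n => splitDigit_surjective (d n, c n)
  refine ⟨ω, ?_⟩
  simp only [combPoint, heightFraction, hω]
  norm_num at hd ⊢
  rw [hd]
  simp

/-- A parametrization of a product of two Cantor sets, far away from the triangular comb. -/
noncomputable def dustPoint (ω : ℕ → Fin 3 × Fin 3) : ℝ × ℝ :=
  (-144 - 24 * digitSum (1 / 4) (fun n => (ω n).1), -24 * digitSum (1 / 4) fun n => (ω n).2)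

lemma fin_three_le (ω : ℕ → Fin 3) (n : ℕ) : (ω n : ℕ) ≤ 2 := by omega

lemma dist_dustPoint (ω ω' : ℕ → Fin 3 × Fin 3) : dist (dustPoint ω) (dustPoint ω') =
    24 * max |digitSum (1 / 4) (fun n => (ω n).1) - digitSum (1 / 4) (fun n => (ω' n).1)|
      |digitSum (1 / 4) (fun n => (ω n).2) - digitSum (1 / 4) (fun n => (ω' n).2)| := by
  have key : ∀ a x y : ℝ, |(a - 24 * x) - (a - 24 * y)| = 24 * |x - y| := by
    intro a x y
    rw [sub_sub_sub_cancel_left, ← mul_sub, abs_mul, abs_sub_comm y]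
    norm_num
  rw [Prod.dist_eq, Real.dist_eq, Real.dist_eq, mul_max_of_nonneg _ _ (by norm_num), ← key (-144),
    ← key 0]
  simp [dustPoint]

lemma dist_dustPoint_le (n : ℕ) {ω ω' : ℕ → Fin 3 × Fin 3} (h : ∀ i < n, ω i = ω' i) :
    dist (dustPoint ω) (dustPoint ω') ≤ 64 * (1 / 4) ^ n := by
  have h1 := abs_digitSum_sub_le (ρ := 1 / 4) (by norm_num) (by norm_num) n
    (fin_three_le fun n => (ω n).1) (fin_three_le fun n => (ω' n).1) fun i hi => by rw [h i hi]
  have h2 := abs_digitSum_sub_le (ρ := 1 / 4) (by norm_num) (by norm_num) n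
    (fin_three_le fun n => (ω n).2) (fin_three_le fun n => (ω' n).2) fun i hi => by rw [h i hi]
  rw [dist_dustPoint]
  refine (mul_le_mul_of_nonneg_left (max_le h1 h2) (by norm_num)).trans (le_of_eq ?_)
  norm_num
  ring

lemma le_dist_dustPoint (n : ℕ) {ω ω' : ℕ → Fin 3 × Fin 3} (h : ∀ i < n, ω i = ω' i)
    (hn : ω n ≠ ω' n) : 8 * (1 / 4) ^ n ≤ dist (dustPoint ω) (dustPoint ω') := by
  rw [dist_dustPoint]
  have key : ∀ p : Fin 3 × Fin 3 → Fin 3, p (ω n) ≠ p (ω' n) → (1 / 3) * (1 / 4) ^ n ≤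
      |digitSum (1 / 4) (fun n => p (ω n)) - digitSum (1 / 4) (fun n => p (ω' n))| := by
    intro p hp
    have h1 := le_abs_digitSum_sub (ρ := 1 / 4) (by norm_num) (by norm_num) n
      (fin_three_le fun n => p (ω n)) (fin_three_le fun n => p (ω' n))
      (fun i hi => by rw [h i hi]) (fun h => hp (Fin.ext h))
    refine le_trans (le_of_eq ?_) h1
    norm_num
  by_cases h1 : (ω n).1 = (ω' n).1
  · have h2 := key Prod.snd fun h => hn (Prod.ext h1 h)
    linarith [h2.trans (le_max_right
      |digitSum (1 / 4) (fun n => (ω n).1) - digitSum (1 / 4) (fun n => (ω' n).1)| _)]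
  · linarith [(key Prod.fst h1).trans (le_max_left _
      |digitSum (1 / 4) (fun n => (ω n).2) - digitSum (1 / 4) (fun n => (ω' n).2)|)]

lemma dustPoint_fst_le (ω : ℕ → Fin 3 × Fin 3) : (dustPoint ω).1 ≤ -144 := by
  have := digitSum_nonneg (ρ := 1 / 4) (a := fun n => (ω n).1) (by norm_num)
  simp only [dustPoint]
  linarith

lemma dist_dustPoint_consSeq (a : Fin 3 × Fin 3) (ω ω' : ℕ → Fin 3 × Fin 3) :
    dist (dustPoint (consSeq a ω)) (dustPoint (consSeq a ω')) =
      1 / 4 * dist (dustPoint ω) (dustPoint ω') := by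
  have key : ∀ (p : Fin 3 × Fin 3 → Fin 3) (ω : ℕ → Fin 3 × Fin 3),
      digitSum (1 / 4) (fun n => p (consSeq a ω n)) =
        p a + 1 / 4 * digitSum (1 / 4) (fun n => p (ω n)) := fun p ω =>
    digitSum_eq_head_add (by norm_num) (by norm_num) (fin_three_le fun n => p (consSeq a ω n))
  rw [dist_dustPoint, dist_dustPoint, key Prod.fst, key Prod.fst, key Prod.snd, key Prod.snd,
    add_sub_add_left_eq_sub, add_sub_add_left_eq_sub, ← mul_sub, ← mul_sub, abs_mul, abs_mul,
    abs_of_pos (by norm_num : (0 : ℝ) < 1 / 4), ← mul_max_of_nonneg _ _ (by norm_num)]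
  ring

lemma continuous_combPoint : Continuous combPoint :=
  continuous_of_dist_le_pow (ρ := 1 / 4) (by norm_num) (by norm_num)
    fun n _ _ h => dist_combPoint_le n h

lemma continuous_dustPoint : Continuous dustPoint :=
  continuous_of_dist_le_pow (ρ := 1 / 4) (by norm_num) (by norm_num)
    fun n _ _ h => dist_dustPoint_le n h

lemma dustPoint_injective : Function.Injective dustPoint := by
  intro ω ω' h
  by_contra hne
  obtain ⟨n, hn, hn'⟩ := exists_first_difference hne
  have h1 := le_dist_dustPoint n hn hn'
  rw [h, dist_self] at h1
  have : (0 : ℝ) < (1 / 4) ^ n := by positivity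
  linarith

lemma dist_combPoint_le_half (ω ω' : ℕ → Fin 3 × Fin 3) :
    dist (combPoint ω) (combPoint ω') ≤ 1 / 2 * dist (dustPoint ω) (dustPoint ω') := by
  by_cases hne : ω = ω'
  · simp [hne]
  obtain ⟨n, hn, hn'⟩ := exists_first_difference hne
  linarith [dist_combPoint_le n hn, le_dist_dustPoint n hn hn']

/-- The union of the triangular comb and of the Cantor dust. -/
def attractor : Set (ℝ × ℝ) := range combPoint ∪ range dustPoint

lemma isCompact_attractor : IsCompact attractor :=
  (isCompact_range continuous_combPoint).union (isCompact_range continuous_dustPoint)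

lemma exists_lipschitzWith_range_eq {Ω Y Z : Type*} [Nonempty Ω] [MetricSpace Y] [MetricSpace Z]
    {e : Ω → Y} {G : Ω → Z} {M : ℝ} (hG : ∀ ω ω', dist (G ω) (G ω') ≤ 1 / 2 * dist (e ω) (e ω'))
    (hM : ∀ ω ω', dist (G ω) (G ω') ≤ M / 2) (he : ∀ x ∉ range e, ∀ ω, M ≤ dist x (e ω)) :
    ∃ Ψ : Y → Z, LipschitzWith (1 / 2) Ψ ∧ range Ψ = range G := by
  have hinv : ∀ {x}, x ∈ range e → e (Function.invFun e x) = x := fun hx => Function.invFun_eq hx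
  refine ⟨fun x => G (Function.invFun e x), LipschitzWith.of_dist_le_mul fun x y => ?_, ?_⟩
  · push_cast
    by_cases hx : x ∈ range e <;> by_cases hy : y ∈ range e
    · simpa [hinv hx, hinv hy] using hG (Function.invFun e x) (Function.invFun e y)
    · have := he y hy (Function.invFun e x)
      rw [hinv hx, dist_comm] at this
      linarith [hM (Function.invFun e x) (Function.invFun e y)]
    · have := he x hx (Function.invFun e y)
      rw [hinv hy] at this
      linarith [hM (Function.invFun e x) (Function.invFun e y)]
    · rw [Function.invFun_neg hx, Function.invFun_neg hy, dist_self]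
      positivity
  · refine Subset.antisymm (range_comp_subset_range _ _) ?_
    rintro _ ⟨ω, rfl⟩
    refine ⟨e ω, ?_⟩
    have := hG (Function.invFun e (e ω)) ω
    rw [hinv ⟨ω, rfl⟩, dist_self, mul_zero] at this
    exact dist_le_zero.1 this

/-- `combPoint` as a point of the attractor. -/
noncomputable def combPt (ω : ℕ → Fin 3 × Fin 3) : attractor := ⟨combPoint ω, Or.inl ⟨ω, rfl⟩⟩

/-- `dustPoint` as a point of the attractor. -/
noncomputable def dustPt (ω : ℕ → Fin 3 × Fin 3) : attractor := ⟨dustPoint ω, Or.inr ⟨ω, rfl⟩⟩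

lemma exists_eq_combPt_or_dustPt (p : attractor) : (∃ ω, combPt ω = p) ∨ ∃ ω, dustPt ω = p := by
  obtain ⟨p, ⟨ω, rfl⟩ | ⟨ω, rfl⟩⟩ := p
  · exact Or.inl ⟨ω, rfl⟩
  · exact Or.inr ⟨ω, rfl⟩

lemma combPt_fst_nonneg (ω : ℕ → Fin 3 × Fin 3) : 0 ≤ (combPt ω).1.1 := coord_nonneg _

lemma dustPt_fst_le (ω : ℕ → Fin 3 × Fin 3) : (dustPt ω).1.1 ≤ -144 := dustPoint_fst_le ω

lemma le_dist_dustPt {p : attractor} (hp : p ∉ range dustPt) (ω : ℕ → Fin 3 × Fin 3) :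
    144 ≤ dist p (dustPt ω) := by
  rcases exists_eq_combPt_or_dustPt p with ⟨ω', rfl⟩ | h
  · have h1 := combPt_fst_nonneg ω'
    have h2 := dustPt_fst_le ω
    have h3 : dist (combPt ω').1.1 (dustPt ω).1.1 ≤ dist (combPt ω') (dustPt ω) :=
      le_max_left _ _
    rw [Real.dist_eq] at h3
    linarith [le_abs_self ((combPt ω').1.1 - (dustPt ω).1.1)]
  · exact absurd h hp

lemma exists_contractions_attractor : ∃ (m : ℕ) (Ψ : Fin m → attractor → attractor),
    (∀ i, ∃ c : NNReal, c < 1 ∧ LipschitzWith c (Ψ i)) ∧ (⋃ i, range (Ψ i)) = univ := by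
  have h1 : ∃ Ψ : attractor → attractor, LipschitzWith (1 / 2) Ψ ∧ range Ψ = range combPt := by
    refine exists_lipschitzWith_range_eq (e := dustPt) (M := 144) dist_combPoint_le_half
      (fun ω ω' => ?_) fun p hp ω => le_dist_dustPt hp ω
    have := dist_combPoint_le 0 (ω := ω) (ω' := ω') (by simp)
    change dist (combPoint ω) (combPoint ω') ≤ _
    linarith
  have h2 : ∀ a, ∃ Ψ : attractor → attractor, LipschitzWith (1 / 2) Ψ ∧
      range Ψ = range fun ω => dustPt (consSeq a ω) := by
    refine fun a => exists_lipschitzWith_range_eq (e := dustPt) (M := 144) (fun ω ω' => ?_)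
      (fun ω ω' => ?_) fun p hp ω => le_dist_dustPt hp ω
    · change dist (dustPoint (consSeq a ω)) (dustPoint (consSeq a ω')) ≤
        1 / 2 * dist (dustPoint ω) (dustPoint ω')
      rw [dist_dustPoint_consSeq]
      gcongr
      norm_num
    · have := dist_dustPoint_le 0 (ω := consSeq a ω) (ω' := consSeq a ω') (by simp)
      change dist (dustPoint (consSeq a ω)) (dustPoint (consSeq a ω')) ≤ _
      linarith
  obtain ⟨Φ, hΦ, hΦr⟩ := h1
  choose Ψ hΨ hΨr using h2
  let F : Option (Fin 3 × Fin 3) → attractor → attractor := fun o => o.elim Φ Ψ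
  have hF : ∀ o, LipschitzWith (1 / 2) (F o) := by
    rintro (_ | a)
    · exact hΦ
    · exact hΨ a
  let e := Fintype.equivFin (Option (Fin 3 × Fin 3))
  refine ⟨_, fun i => F (e.symm i), fun i => ⟨1 / 2, by norm_num, hF _⟩, ?_⟩
  refine eq_univ_of_forall fun p => ?_
  rw [e.symm.surjective.iUnion_comp fun o => range (F o), mem_iUnion]
  rcases exists_eq_combPt_or_dustPt p with h | ⟨ω, rfl⟩
  · exact ⟨none, hΦr.symm.subset h⟩
  · refine ⟨some (ω 0), (hΨr (ω 0)).symm.subset ⟨fun n => ω (n + 1), ?_⟩⟩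
    simp only [consSeq_head_tail]

instance : CompactSpace attractor := isCompact_iff_compactSpace.1 isCompact_attractor

lemma exists_val_eq (c : ℕ → Bool) {t : ℝ} (ht : t ∈ Icc (0 : ℝ) 1) :
    ∃ p : attractor, p.1 = (coord c, coord c * t) := by
  obtain ⟨ω, hω⟩ := exists_combPoint_eq c ht
  exact ⟨combPt ω, hω⟩

/-- The corner of the triangular comb. -/
noncomputable def corner : attractor :=
  ⟨(0, 0), by
    obtain ⟨p, hp⟩ := exists_val_eq (fun _ => false) (t := 0) (by simp)
    rw [coord_eq_zero (by simp)] at hp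
    have := p.2
    rwa [hp, mul_zero] at this⟩

instance : Nonempty attractor := ⟨corner⟩

/-- The point at relative height `t` on the vertical segment of the comb over `coord c`. -/
noncomputable def segmentPt (c : ℕ → Bool) (t : unitInterval) : attractor :=
  ⟨(coord c, coord c * t), by
    obtain ⟨p, hp⟩ := exists_val_eq c t.2
    exact hp ▸ p.2⟩

lemma continuous_segmentPt (c : ℕ → Bool) : Continuous (segmentPt c) := by
  unfold segmentPt
  fun_prop

lemma combPt_fst_snd (ω : ℕ → Fin 3 × Fin 3) : ∃ c : ℕ → Bool, (combPt ω).1.1 = coord c ∧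
    0 ≤ (combPt ω).1.2 ∧ (combPt ω).1.2 ≤ (combPt ω).1.1 := by
  obtain ⟨h0, h1⟩ := heightFraction_mem ω
  have h2 := combPt_fst_nonneg ω
  exact ⟨_, rfl, mul_nonneg h2 h0, mul_le_of_le_one_right h2 h1⟩

lemma dist_corner_le {p : attractor} (hp : -1 < p.1.1) : dist p corner ≤ p.1.1 := by
  rcases exists_eq_combPt_or_dustPt p with ⟨ω, rfl⟩ | ⟨ω, rfl⟩
  · obtain ⟨c, h1, h2, h3⟩ := combPt_fst_snd ω
    refine max_le ?_ ?_
    · rw [Real.dist_eq]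
      simp only [corner, sub_zero]
      rw [abs_of_nonneg (h2.trans h3)]
    · rw [Real.dist_eq]
      simp only [corner, sub_zero]
      rwa [abs_of_nonneg h2]
  · linarith [dustPt_fst_le ω]

/-- The first coordinate, with the dust collapsed. -/
noncomputable def foldedFst : C(attractor, ℝ) where
  toFun p := max p.1.1 (-1)
  continuous_toFun := by fun_prop

lemma range_coord_subset : range coord ⊆ {0} ∪ ⋃ m, range (pieceCoord m) := by
  rintro _ ⟨c, rfl⟩
  rcases coord_eq_zero_or c with h | ⟨m, c', h⟩
  · exact Or.inl h
  · exact Or.inr (mem_iUnion.2 ⟨m, c', h.symm⟩)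

lemma dimH_range_pieceCoord_le (m : ℕ) (b : ℝ) :
    dimH (range fun c => (pieceCoord m c, b)) ≤ pieceDim m := by
  rw [← dimH_range_bitSum_ratio]
  refine dimH_range_le_of_dist_le_mul ((1 / 4) ^ m / 4) fun c c' => ?_
  rw [Prod.dist_eq, dist_self, max_eq_left dist_nonneg, Real.dist_eq, Real.dist_eq,
    ← abs_of_nonneg (by positivity : (0 : ℝ) ≤ (1 / 4) ^ m / 4), ← abs_mul]
  refine le_of_eq (congrArg _ ?_)
  simp only [pieceCoord]
  ring

lemma dense_compl_range_foldedFst : Dense (range foldedFst)ᶜ := by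
  have hsub : range foldedFst ⊆ {-1} ∪ ({0} ∪ ⋃ m, range (pieceCoord m)) := by
    rintro _ ⟨p, rfl⟩
    rcases exists_eq_combPt_or_dustPt p with ⟨ω, rfl⟩ | ⟨ω, rfl⟩
    · have h := combPt_fst_nonneg ω
      refine Or.inr (range_coord_subset ?_)
      exact ⟨_, (max_eq_left (show (-1 : ℝ) ≤ (combPt ω).1.1 by linarith)).symm⟩
    · exact Or.inl (max_eq_right (by linarith [dustPt_fst_le ω]))
  have hdim : dimH (range foldedFst) ≤ baseDim := by
    refine (dimH_mono hsub).trans ?_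
    rw [dimH_union, dimH_union, dimH_singleton, dimH_singleton, dimH_iUnion]
    refine max_le zero_le (max_le zero_le (iSup_le fun m => ?_))
    refine (dimH_range_le_of_dist_le_mul (a := fun c => (pieceCoord m c, (0 : ℝ))) 1
      fun c c' => ?_).trans ((dimH_range_pieceCoord_le m 0).trans (pieceDim_lt m).le)
    rw [one_mul]
    exact le_max_left _ _
  refine dense_compl_of_dimH_lt_finrank ?_
  rw [Module.finrank_self]
  exact_mod_cast hdim.trans_lt baseDim_lt_one

lemma isClosedEmbedding_dustPt : IsClosedEmbedding dustPt :=
  (continuous_dustPoint.subtype_mk _).isClosedEmbedding fun _ _ h =>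
    dustPoint_injective (congrArg Subtype.val h)

/-- The number with base `100` digits `10 * a + b`, where `(a, b)` are the terms of `ω`. -/
noncomputable def dustCode (ω : ℕ → Fin 3 × Fin 3) : ℝ :=
  digitSum (1 / 100) fun n => 10 * (ω n).1 + (ω n).2

lemma dustCode_digit_le (ω : ℕ → Fin 3 × Fin 3) (n : ℕ) :
    10 * ((ω n).1 : ℕ) + (ω n).2 ≤ 22 := by omega

lemma continuous_dustCode : Continuous dustCode := by
  refine continuous_of_dist_le_pow (c := (22 : ℕ) / (1 - 1 / 100)) (ρ := 1 / 100) (by norm_num)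
    (by norm_num) fun n ω ω' h => ?_
  exact abs_digitSum_sub_le (by norm_num) (by norm_num) n (dustCode_digit_le ω)
    (dustCode_digit_le ω') fun i hi => by rw [h i hi]

lemma dustCode_injective : Function.Injective dustCode := by
  intro ω ω' h
  by_contra hne
  obtain ⟨n, hn, hn'⟩ := exists_first_difference hne
  have h1 := le_abs_digitSum_sub (ρ := 1 / 100) (by norm_num) (by norm_num) n
    (dustCode_digit_le ω) (dustCode_digit_le ω') (fun i hi => by rw [hn i hi])
    (fun h => hn' (Prod.ext (by omega) (by omega)))
  change _ ≤ |dustCode ω - dustCode ω'| at h1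
  rw [h, sub_self, abs_zero] at h1
  have : (0 : ℝ) < (1 / 100) ^ n := by positivity
  norm_num at h1
  linarith

lemma exists_slicing_function : ∃ w : C(attractor, ℝ), (∀ ω, w (combPt ω) = (combPt ω).1.2) ∧
    ∀ ω, w (dustPt ω) = dustCode ω := by
  obtain ⟨F, hF⟩ := ContinuousMap.exists_extension isClosedEmbedding_dustPt
    ⟨dustCode, continuous_dustCode⟩
  have hcont : Continuous fun p : attractor => if p.1.1 < -1 then F p else p.1.2 := by
    refine continuous_if (fun p hp => ?_) F.continuous.continuousOn (by fun_prop)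
    have h1 : p.1.1 = -1 := frontier_lt_subset_eq (by fun_prop) (by fun_prop) hp
    rcases exists_eq_combPt_or_dustPt p with ⟨ω, rfl⟩ | ⟨ω, rfl⟩
    · linarith [combPt_fst_nonneg ω]
    · linarith [dustPt_fst_le ω]
  refine ⟨⟨_, hcont⟩, fun ω => ?_, fun ω => ?_⟩
  · exact if_neg (by linarith [combPt_fst_nonneg ω])
  · have h1 : F (dustPt ω) = dustCode ω := DFunLike.congr_fun hF ω
    rw [← h1]
    exact if_pos (by linarith [dustPt_fst_le ω])

lemma eq_of_foldedFst_eq {w : C(attractor, ℝ)} (h1 : ∀ ω, w (combPt ω) = (combPt ω).1.2)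
    (h2 : ∀ ω, w (dustPt ω) = dustCode ω) (p q : attractor) (h : foldedFst p = foldedFst q)
    (hw : w p = w q) : p = q := by
  change max _ _ = max _ _ at h
  rcases exists_eq_combPt_or_dustPt p with ⟨ω, rfl⟩ | ⟨ω, rfl⟩ <;>
  rcases exists_eq_combPt_or_dustPt q with ⟨ω', rfl⟩ | ⟨ω', rfl⟩
  · rw [max_eq_left (by linarith [combPt_fst_nonneg ω]),
      max_eq_left (by linarith [combPt_fst_nonneg ω'])] at h
    rw [h1, h1] at hw
    exact Subtype.ext (Prod.ext h hw)
  · rw [max_eq_left (by linarith [combPt_fst_nonneg ω]),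
      max_eq_right (by linarith [dustPt_fst_le ω'])] at h
    linarith [combPt_fst_nonneg ω]
  · rw [max_eq_right (by linarith [dustPt_fst_le ω]),
      max_eq_left (by linarith [combPt_fst_nonneg ω'])] at h
    linarith [combPt_fst_nonneg ω']
  · rw [h2, h2] at hw
    rw [dustCode_injective hw]

/-- The part of the attractor not too close to the corner. -/
def awayFromCorner (m : ℕ) : Set attractor := {p | p.1.1 ≤ -1 ∨ (1 / 4) ^ m ≤ p.1.1}

lemma isCompact_awayFromCorner (m : ℕ) : IsCompact (awayFromCorner m) :=
  have h : Continuous fun p : attractor => p.1.1 := by fun_prop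
  ((isClosed_le h continuous_const).union (isClosed_le continuous_const h)).isCompact

lemma exists_mem_awayFromCorner {r : ℝ} (hr : 0 < r) :
    ∃ m, ∀ p, r ≤ dist p corner → p ∈ awayFromCorner m := by
  obtain ⟨m, hm⟩ := exists_pow_lt_of_lt_one hr (by norm_num : (1 / 4 : ℝ) < 1)
  refine ⟨m, fun p hp => ?_⟩
  by_cases h : p.1.1 ≤ -1
  · exact Or.inl h
  · exact Or.inr (hm.le.trans (hp.trans (dist_corner_le (not_le.1 h))))

lemma dimH_slice_le {w : C(attractor, ℝ)} (h1 : ∀ ω, w (combPt ω) = (combPt ω).1.2)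
    (h2 : ∀ ω, w (dustPt ω) = dustCode ω) (m : ℕ) (b : ℝ) :
    dimH (w ⁻¹' {b} ∩ awayFromCorner m) ≤ pieceDim m := by
  have hsub : w ⁻¹' {b} ∩ awayFromCorner m ⊆ (dustPt '' {ω | dustCode ω = b}) ∪
      Subtype.val ⁻¹' ⋃ j ∈ Iic m, range fun c => (pieceCoord j c, b) := by
    rintro p ⟨hp, hpm⟩
    have hp' : w p = b := hp
    rcases exists_eq_combPt_or_dustPt p with ⟨ω, rfl⟩ | ⟨ω, rfl⟩
    · right
      obtain ⟨c, hc, -⟩ := combPt_fst_snd ω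
      have hm : (1 / 4) ^ m ≤ coord c := by
        rcases hpm with h | h
        · linarith [combPt_fst_nonneg ω]
        · rwa [hc] at h
      have hm0 : (0 : ℝ) < (1 / 4) ^ m := by positivity
      rcases coord_eq_zero_or c with h | ⟨j, c', h⟩
      · linarith
      · refine mem_biUnion (x := j) ?_ ⟨c', Prod.ext (by rw [hc, h]) (by rw [← hp', h1])⟩
        by_contra hj
        rw [mem_Iic] at hj
        have h3 := pieceCoord_le j c'
        have h4 : ((1 : ℝ) / 4) ^ j ≤ (1 / 4) ^ (m + 1) :=
          pow_le_pow_of_le_one (by norm_num) (by norm_num) (by omega)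
        rw [pow_succ] at h4
        linarith
    · left
      exact ⟨ω, by rw [← hp', h2]; rfl, rfl⟩
  refine (dimH_mono hsub).trans ?_
  rw [dimH_union]
  refine max_le ?_ ?_
  · refine (Set.Subsingleton.dimH_zero (Subsingleton.image (fun ω hω ω' hω' => ?_) _)).trans_le
      zero_le
    exact dustCode_injective (Eq.trans hω (Eq.symm hω'))
  · rw [← isometry_subtype_coe.dimH_image]
    refine (dimH_mono (image_preimage_subset _ _)).trans ?_
    rw [dimH_bUnion (to_countable _)]
    exact iSup₂_le fun j hj => (dimH_range_pieceCoord_le j b).trans (pieceDim_mono hj)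

lemma dimH_le_baseDim {s : Set attractor} (h : ∀ m, dimH (s ∩ awayFromCorner m) ≤ pieceDim m) :
    dimH s ≤ baseDim := by
  have hsub : s ⊆ {corner} ∪ ⋃ m, s ∩ awayFromCorner m := by
    intro p hp
    by_cases hpc : p = corner
    · exact Or.inl hpc
    · obtain ⟨m, hm⟩ := exists_mem_awayFromCorner (dist_pos.2 hpc)
      exact Or.inr (mem_iUnion.2 ⟨m, hp, hm p le_rfl⟩)
  refine (dimH_mono hsub).trans ?_
  rw [dimH_union, dimH_singleton, dimH_iUnion]
  exact max_le zero_le (iSup_le fun m => (h m).trans (pieceDim_lt m).le)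

lemma bitSum_iterate_consSeq {ρ : ℝ} (h0 : 0 ≤ ρ) (h1 : ρ < 1) (N : ℕ) (c : ℕ → Bool) :
    bitSum ρ ((consSeq false)^[N] c) = ρ ^ N * bitSum ρ c := by
  induction N with
  | zero => simp
  | succ N ih =>
    rw [Function.iterate_succ_apply', pow_succ', mul_assoc, ← ih]
    have := digitSum_eq_head_add h0 h1 (B := 1)
      (a := fun n => (consSeq false ((consSeq false)^[N] c) n).toNat) fun n => Bool.toNat_le _
    simpa [bitSum, consSeq] using this

lemma pieceDim_le_dimH {s : Set attractor} (j N : ℕ)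
    (h : ∀ c, ∃ p ∈ s, p.1.1 = pieceCoord j ((consSeq false)^[N] c)) : pieceDim j ≤ dimH s := by
  have hr0 := ratio_pos j
  have hr := ratio_le j
  choose p hps hp using h
  rw [← dimH_range_bitSum_ratio]
  refine le_trans (dimH_range_le_of_dist_le_mul (a := p) ((1 / 4) ^ j / 4 * ratio j ^ N)⁻¹
    fun c c' => ?_) (dimH_mono (range_subset_iff.2 hps))
  rw [inv_mul_eq_div, le_div_iff₀ (by positivity)]
  refine le_trans (le_of_eq ?_) (show dist (p c).1.1 (p c').1.1 ≤ _ from le_max_left _ _)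
  rw [hp, hp, Real.dist_eq, Real.dist_eq, mul_comm,
    ← abs_of_pos (by positivity : 0 < (1 / 4) ^ j / 4 * ratio j ^ N), ← abs_mul]
  congr 1
  simp only [pieceCoord, bitSum_iterate_consSeq hr0.le (by linarith : ratio j < 1)]
  ring

/-- The bottom left endpoint of the `m`-th piece of the comb. -/
noncomputable def pieceCorner (m : ℕ) : attractor :=
  segmentPt (exists_coord_eq_pieceCoord m fun _ => false).choose 0

lemma bitSum_false (ρ : ℝ) : bitSum ρ (fun _ => false) = 0 := by simp [bitSum, digitSum]

lemma pieceCorner_val (m : ℕ) : (pieceCorner m).1 = ((1 / 4) ^ m, 0) := by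
  have h := (exists_coord_eq_pieceCoord m fun _ => false).choose_spec
  have h' : pieceCoord m (fun _ => false) = (1 / 4) ^ m := by simp [pieceCoord, bitSum_false]
  exact Prod.ext (h.trans h') (mul_zero _)

lemma exists_mem_frontier {U : Set attractor} (hU : IsOpen U) {m : ℕ}
    (hm : pieceCorner m ∈ U) (hU' : ∀ p ∈ U, p.1.2 < (1 / 4) ^ m) :
    ∃ N, ∀ c, ∃ p ∈ frontier U, p.1.1 = pieceCoord m ((consSeq false)^[N] c) := by
  obtain ⟨r, hr, hball⟩ := Metric.isOpen_iff.1 hU _ hm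
  obtain ⟨N, hN⟩ := exists_pow_lt_of_lt_one hr (by norm_num : (1 / 4 : ℝ) < 1)
  refine ⟨N, fun c => ?_⟩
  obtain ⟨c', hc'⟩ := exists_coord_eq_pieceCoord m ((consSeq false)^[N] c)
  have h0 : segmentPt c' 0 ∈ U := by
    refine hball (show dist (segmentPt c' 0).1 (pieceCorner m).1 < r from ?_)
    have hr0 := ratio_pos m
    have hr1 := ratio_le m
    have hb := bitSum_ratio_le m c
    have hb0 := bitSum_nonneg hr0.le c
    rw [pieceCorner_val, Prod.dist_eq]
    simp only [segmentPt, hc', pieceCoord, bitSum_iterate_consSeq hr0.le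
      (by linarith : ratio m < 1)]
    refine max_lt ?_ (by simpa using hr)
    rw [Real.dist_eq, mul_one_add, add_sub_cancel_left, abs_of_nonneg (by positivity)]
    calc (1 / 4 : ℝ) ^ m * (ratio m ^ N * bitSum (ratio m) c / 4)
        ≤ 1 * ((1 / 4) ^ N * 4 / 4) := by
          gcongr
          · exact pow_le_one₀ (by norm_num) (by norm_num)
          · linarith
      _ < r := by linarith
  have h1 : segmentPt c' 1 ∉ U := fun h => by
    have h2 := hU' _ h
    simp only [segmentPt, Icc.coe_one, mul_one, hc'] at h2
    exact h2.not_ge (le_pieceCoord _ _)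
  obtain ⟨t, ht⟩ := nonempty_frontier_iff.2 ⟨(⟨0, h0⟩ : (segmentPt c' ⁻¹' U).Nonempty),
    (ne_univ_iff_exists_notMem _).2 ⟨1, h1⟩⟩
  exact ⟨_, (continuous_segmentPt c').frontier_preimage_subset U ht, hc'⟩

lemma tHdim_attractor : tHdim attractor = (baseDim : EReal) + 1 := by
  obtain ⟨w, hw1, hw2⟩ := exists_slicing_function
  refine le_antisymm (tHdim_le_of_dimH_level_le dense_compl_range_foldedFst
    (eq_of_foldedFst_eq hw1 hw2) fun b => dimH_le_baseDim fun m => dimH_slice_le hw1 hw2 m b) ?_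
  rw [tHdim, if_pos ⟨corner⟩]
  refine le_sInf fun d ⟨𝒰, hbasis, hd⟩ => ?_
  have key : ∀ m, (pieceDim m : EReal) ≤ d - 1 := by
    intro m
    have hopen : IsOpen {p : attractor | p.1.2 < (1 / 4) ^ m} :=
      isOpen_lt (by fun_prop) (by fun_prop)
    obtain ⟨U, hU, hmU, hUV⟩ := hbasis.exists_subset_of_mem_open
      (show pieceCorner m ∈ {p : attractor | p.1.2 < (1 / 4) ^ m} by
        simp only [mem_ofPred_eq, pieceCorner_val]
        positivity) hopen
    obtain ⟨N, hN⟩ := exists_mem_frontier (hbasis.isOpen hU) hmU fun p hp => hUV hp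
    have h1 := pieceDim_le_dimH m N hN
    obtain ⟨p, h2, -⟩ := hN fun _ => false
    exact (EReal.coe_ennreal_le_coe_ennreal_iff.2 h1).trans
      ((hdim_of_nonempty ⟨p, h2⟩).symm.le.trans (hd U hU))
  have h0 : 0 ≤ d - 1 := (EReal.coe_ennreal_nonneg _).trans (key 0)
  have h1 : baseDim ≤ (d - 1).toENNReal := baseDim_le_of_forall fun m => by
    rw [← EReal.coe_ennreal_le_coe_ennreal_iff, EReal.coe_toENNReal h0]
    exact key m
  rw [← EReal.coe_ennreal_le_coe_ennreal_iff, EReal.coe_toENNReal h0] at h1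
  exact EReal.add_le_of_le_sub h1

/-! ### The generic continuous function -/

lemma dense_interior_separating (m : ℕ) : Dense (interior {f : C(attractor, ℝ) | ∃ j ≥ m, ∀ c,
    ∀ c', coord c' = pieceCoord j c → f (segmentPt c' 0) < f corner ∧
      f corner < f (segmentPt c' 1)}) := by
  refine Metric.dense_iff.2 fun f ε hε => ?_
  obtain ⟨r, hr, hfr⟩ := Metric.continuousAt_iff.1 f.continuous.continuousAt (ε / 4) (by positivity)
  obtain ⟨k, hk⟩ := exists_pow_lt_of_lt_one (show 0 < r / 2 by positivity)
    (by norm_num : (1 / 4 : ℝ) < 1)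
  set j := max m k
  have hj : ((1 : ℝ) / 4) ^ j < r / 2 :=
    (pow_le_pow_of_le_one (by norm_num) (by norm_num) (le_max_right m k)).trans_lt hk
  let h : C(attractor, ℝ) := ⟨fun p => max (-1) (min 1 ((2 * p.1.2 - p.1.1) * 4 ^ j)), by fun_prop⟩
  have hle : ‖(ε / 2) • h‖ ≤ ε / 2 := by
    refine (ContinuousMap.norm_le _ (by positivity)).2 fun p => ?_
    have h1 : |h p| ≤ 1 := abs_le.2 ⟨le_max_left _ _, max_le (by norm_num) (min_le_left _ _)⟩
    rw [ContinuousMap.smul_apply, norm_smul, Real.norm_eq_abs, Real.norm_eq_abs,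
      abs_of_pos (by positivity : 0 < ε / 2)]
    exact mul_le_of_le_one_right (by positivity) h1
  have hcorner : h corner = 0 := by simp [h, corner]
  refine ⟨f + (ε / 2) • h, ?_, mem_interior.2 ⟨ball (f + (ε / 2) • h) (ε / 8), fun g hg => ?_,
    isOpen_ball, mem_ball_self (by positivity)⟩⟩
  · rw [mem_ball, dist_eq_norm, add_sub_cancel_left]
    linarith
  refine ⟨j, le_max_left _ _, fun c c' hc => ?_⟩
  have hg' : ∀ p, |g p - (f p + ε / 2 * h p)| < ε / 8 := fun p =>
    (ContinuousMap.dist_apply_le_dist p).trans_lt hg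
  have hpos : (0 : ℝ) < (1 / 4) ^ j := by positivity
  have hlow := le_pieceCoord j c
  have hup := pieceCoord_le j c
  have hx1 : 1 ≤ coord c' * 4 ^ j := by
    rw [hc]
    calc (1 : ℝ) = (1 / 4) ^ j * 4 ^ j := by rw [← mul_pow]; norm_num
      _ ≤ _ := by gcongr
  have hnear : ∀ t, |f (segmentPt c' t) - f corner| < ε / 4 := fun t => by
    refine hfr ((dist_corner_le ?_).trans_lt ?_) <;> simp only [segmentPt, hc] <;> linarith
  have hh0 : h (segmentPt c' 0) = -1 := by
    refine max_eq_left ((min_le_right _ _).trans ?_)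
    simp only [segmentPt, Icc.coe_zero]
    linarith
  have hh1 : h (segmentPt c' 1) = 1 := by
    change max _ (min _ _) = _
    rw [min_eq_left, max_eq_right (by norm_num)]
    simp only [segmentPt, Icc.coe_one]
    linarith
  have e1 := abs_lt.1 (hg' corner)
  have e2 := abs_lt.1 (hg' (segmentPt c' 0))
  have e3 := abs_lt.1 (hg' (segmentPt c' 1))
  rw [hcorner] at e1
  rw [hh0] at e2
  rw [hh1] at e3
  have e4 := abs_lt.1 (hnear 0)
  have e5 := abs_lt.1 (hnear 1)
  constructor <;> linarith

lemma residual_forall_le_dimH_corner_level : {f : C(attractor, ℝ) | ∀ m,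
    pieceDim m ≤ dimH (f ⁻¹' {f corner})} ∈ residual C(attractor, ℝ) := by
  filter_upwards [eventually_countable_forall.2 fun m =>
    mem_residual_of_dense_interior (dense_interior_separating m)] with f hf m
  obtain ⟨j, hj, h⟩ := hf m
  refine (pieceDim_mono hj).trans (pieceDim_le_dimH j 0 fun c => ?_)
  obtain ⟨c', hc'⟩ := exists_coord_eq_pieceCoord j c
  obtain ⟨h0, h1⟩ := h c c' hc'
  obtain ⟨t, ht⟩ := mem_range_of_exists_le_of_exists_ge
    (f.continuous.comp (continuous_segmentPt c')) ⟨0, h0.le⟩ ⟨1, h1.le⟩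
  exact ⟨_, ht, hc'⟩

lemma residual_forall_dimH_inter_awayFromCorner_le : {f : C(attractor, ℝ) | ∀ m y,
    dimH (f ⁻¹' {y} ∩ awayFromCorner m) ≤ pieceDim m} ∈ residual C(attractor, ℝ) := by
  obtain ⟨w, hw1, hw2⟩ := exists_slicing_function
  exact eventually_countable_forall.2 fun m => residual_forall_dimH_level_le
    dense_compl_range_foldedFst (eq_of_foldedFst_eq hw1 hw2) (isCompact_awayFromCorner m)
    (dimH_slice_le hw1 hw2 m)

/-- There is a compact set `K ⊆ ℝ²` which is an attractor of an iterated
function system (a nonempty compact set equal to the union of its images under finitely many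
contractions of itself) such that the generic `f ∈ C(K)` has a *unique* level set of Hausdorff
dimension `dim_tH K − 1`. -/
theorem exists_attractor_with_unique_maximal_level_set :
    ∃ K : Set (ℝ × ℝ), IsCompact K ∧ K.Nonempty ∧
      (∃ (m : ℕ) (Ψ : Fin m → K → K),
        (∀ i, ∃ c : NNReal, c < 1 ∧ LipschitzWith c (Ψ i)) ∧
        (⋃ i, Set.range (Ψ i)) = Set.univ) ∧
      {f : C(K, ℝ) | ∃! y : ℝ, hdim (⇑f ⁻¹' {y}) = tHdim K - 1} ∈ residual C(K, ℝ) := by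
  refine ⟨attractor, isCompact_attractor, ⟨_, corner.2⟩, exists_contractions_attractor, ?_⟩
  filter_upwards [residual_forall_le_dimH_corner_level,
    residual_forall_dimH_inter_awayFromCorner_le] with f hlow hup
  have htH : tHdim attractor - 1 = baseDim := by
    rw [tHdim_attractor]
    exact EReal.add_sub_cancel_right (b := 1)
  simp only [htH]
  refine ⟨f corner, ?_, fun y hy => ?_⟩
  · dsimp only
    rw [hdim_of_nonempty (s := f ⁻¹' {f corner}) ⟨corner, mem_singleton _⟩,
      le_antisymm (dimH_le_baseDim fun m => hup m _) (baseDim_le_of_forall hlow)]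
  · by_contra hne
    have hopen : IsOpen {p | f p ≠ y} := isOpen_ne_fun f.continuous continuous_const
    obtain ⟨r, hr, hball⟩ := Metric.isOpen_iff.1 hopen corner (Ne.symm hne)
    obtain ⟨m, hm⟩ := exists_mem_awayFromCorner hr
    have hsub : f ⁻¹' {y} ⊆ awayFromCorner m := fun p hp =>
      hm p (not_lt.1 fun hlt => hball (mem_ball.2 hlt) hp)
    have h1 := hup m y
    rw [inter_eq_left.2 hsub] at h1
    have h2 := (EReal.coe_ennreal_le_coe_ennreal_iff.2 h1)
    refine absurd (hy.symm.le.trans ((hdim_le _).trans h2)) (not_le.2 ?_)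
    exact EReal.coe_ennreal_lt_coe_ennreal_iff.2 (pieceDim_lt m)
end

section
/- Let K be a compact metric space. Then for the generic f ∈ C(K) the graph of f satisfies dim_H graph(f) = dim_H K, where graph(f) = {(x, f(x)) : x ∈ K} ⊆ K × ℝ. -/
open MeasureTheory Topology Metric Set
open scoped Classical

open scoped NNReal ENNReal

section FineOpenCover

variable {X : Type*} [EMetricSpace X]

/-- `s` has a countable open cover by sets of diameter at most `ε` whose `d`-dimensional
Hausdorff sum is at most `ε`. -/
def HasFineOpenCover (d : ℝ) (ε : ℝ≥0∞) (s : Set X) : Prop :=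
  ∃ t : ℕ → Set X, (∀ i, IsOpen (t i)) ∧ s ⊆ ⋃ i, t i ∧ (∀ i, ediam (t i) ≤ ε) ∧
    ∑' i, ediam (t i) ^ d ≤ ε

theorem exists_isOpen_superset_ediam_rpow_lt {d : ℝ} (hd : 0 ≤ d) {s : Set X} {ε η : ℝ≥0∞}
    (hs : ediam s < ε) (hη : η ≠ 0) :
    ∃ u, IsOpen u ∧ s ⊆ u ∧ ediam u ≤ ε ∧ ediam u ^ d ≤ ediam s ^ d + η := by
  have hlim : Filter.Tendsto (fun δ : ℝ≥0 => ediam s + 2 * (δ : ℝ≥0∞)) (𝓝[>] 0) (𝓝 (ediam s)) := by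
    have hc : Continuous fun δ : ℝ≥0 => ediam s + 2 * (δ : ℝ≥0∞) :=
      continuous_const.add
        ((ENNReal.continuous_const_mul (by simp)).comp ENNReal.continuous_coe)
    simpa using (hc.tendsto 0).mono_left nhdsWithin_le_nhds
  have hpow : ediam s ^ d < ediam s ^ d + η :=
    ENNReal.lt_add_right (ENNReal.rpow_ne_top_of_nonneg hd hs.ne_top) hη
  have h₁ := hlim.eventually (eventually_lt_nhds hs)
  have h₂ := (((ENNReal.continuous_rpow_const (y := d)).tendsto _).comp hlim).eventually
    (eventually_lt_nhds hpow)
  obtain ⟨δ, ⟨hδ₁, hδ₂⟩, hδ⟩ := ((h₁.and h₂).and self_mem_nhdsWithin).exists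
  have hle := ediam_thickening_le (s := s) δ
  exact ⟨thickening δ s, isOpen_thickening, self_subset_thickening (by exact_mod_cast hδ) s,
    hle.trans hδ₁.le, (ENNReal.rpow_le_rpow hle hd).trans hδ₂.le⟩

theorem hasFineOpenCover_of_dimH_lt {s : Set X} {d : ℝ≥0} (h : dimH s < d) {ε : ℝ≥0∞}
    (hε : ε ≠ 0) (hε' : ε ≠ ∞) : HasFineOpenCover d ε s := by
  borelize X
  have hd : (0 : ℝ) < d := by exact_mod_cast (zero_le (a := dimH s)).trans_lt h
  have hhalf : 0 < ε / 2 := ENNReal.half_pos hε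
  have h0 := hausdorffMeasure_of_dimH_lt h
  rw [Measure.hausdorffMeasure_apply] at h0
  have hinf := (le_iSup₂ (f := fun (r : ℝ≥0∞) (_ : 0 < r) =>
    ⨅ (t : ℕ → Set X) (_ : s ⊆ ⋃ n, t n) (_ : ∀ n, ediam (t n) ≤ r),
      ∑' n, ⨆ _ : (t n).Nonempty, ediam (t n) ^ (d : ℝ)) (ε / 2) hhalf).trans_lt
    (h0.trans_lt hhalf)
  simp only [iInf_lt_iff] at hinf
  obtain ⟨t, hst, htd, hsum⟩ := hinf
  obtain ⟨η, hη, hηsum⟩ := ENNReal.exists_pos_sum_of_countable' hhalf.ne' ℕ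
  choose u huo htu hud hup using fun i => exists_isOpen_superset_ediam_rpow_lt hd.le
    ((htd i).trans_lt (ENNReal.half_lt_self hε hε')) (hη i).ne'
  refine ⟨u, huo, hst.trans (iUnion_mono htu), hud, ?_⟩
  calc ∑' i, ediam (u i) ^ (d : ℝ)
      ≤ ∑' i, ((⨆ _ : (t i).Nonempty, ediam (t i) ^ (d : ℝ)) + η i) := by
        refine ENNReal.tsum_le_tsum fun i => (hup i).trans ?_
        gcongr
        rcases (t i).eq_empty_or_nonempty with hi | hi
        · simp [hi, ENNReal.zero_rpow_of_pos hd]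
        · simp [hi]
    _ = (∑' i, ⨆ _ : (t i).Nonempty, ediam (t i) ^ (d : ℝ)) + ∑' i, η i := ENNReal.tsum_add
    _ ≤ ε / 2 + ε / 2 := add_le_add hsum.le hηsum.le
    _ = ε := ENNReal.add_halves ε

theorem dimH_le_of_forall_hasFineOpenCover {s : Set X} {d : ℝ≥0}
    (h : ∀ n : ℕ, HasFineOpenCover d ((n : ℝ≥0∞) + 1)⁻¹ s) : dimH s ≤ d := by
  borelize X
  have hlim : Filter.Tendsto (fun n : ℕ => ((n : ℝ≥0∞) + 1)⁻¹) Filter.atTop (𝓝 0) := by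
    simpa using (Filter.tendsto_add_atTop_iff_nat 1).2 ENNReal.tendsto_inv_nat_nhds_zero
  refine dimH_le_of_hausdorffMeasure_ne_top (ne_top_of_le_ne_top ENNReal.zero_ne_top ?_)
  rw [Measure.hausdorffMeasure_apply]
  refine iSup₂_le fun r hr => ENNReal.le_of_forall_pos_le_add fun ε hε _ => ?_
  have hε' : (0 : ℝ≥0∞) < ε := by exact_mod_cast hε
  obtain ⟨n, hnr, hnε⟩ := ((hlim.eventually (eventually_lt_nhds hr)).and
    (hlim.eventually (eventually_lt_nhds hε'))).exists
  obtain ⟨t, -, hst, htd, hsum⟩ := h n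
  refine iInf_le_of_le t <| iInf_le_of_le hst <|
    iInf_le_of_le (fun i => (htd i).trans hnr.le) ?_
  rw [zero_add]
  refine le_trans (ENNReal.tsum_le_tsum fun i => ?_) (hsum.trans hnε.le)
  exact iSup_le fun _ => le_rfl

end FineOpenCover

section Graph

variable {K : Type*} [MetricSpace K]

theorem dimH_univ_le_dimH_graph (f : K → ℝ) :
    dimH (univ : Set K) ≤ dimH (range fun x => (x, f x)) := by
  have h := LipschitzWith.prod_fst (α := K) (β := ℝ) |>.dimH_image_le (range fun x => (x, f x))
  rwa [← range_comp, show Prod.fst ∘ (fun x => (x, f x)) = id from rfl, range_id] at h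

theorem LocallyLipschitz.mul_real {f g : K → ℝ} (hf : LocallyLipschitz f)
    (hg : LocallyLipschitz g) : LocallyLipschitz fun x => f x * g x :=
  (contDiff_mul (𝕜 := ℝ) (𝔸 := ℝ) (n := 1)).locallyLipschitz.comp (hf.prodMk hg)

variable [CompactSpace K]

theorem LocallyLipschitz.dimH_graph_le {f : K → ℝ} (hf : LocallyLipschitz f) :
    dimH (range fun x => (x, f x)) ≤ dimH (univ : Set K) :=
  dimH_range_le_of_locally_lipschitzOn (LocallyLipschitz.id.prodMk hf)

variable (K) in
/-- The subalgebra of locally Lipschitz functions in `C(K, ℝ)`. -/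
def locallyLipschitzSubalgebra : Subalgebra ℝ C(K, ℝ) where
  carrier := {f | LocallyLipschitz f}
  mul_mem' hf hg := hf.mul_real hg
  add_mem' hf hg := hf.add hg
  algebraMap_mem' r := LocallyLipschitz.const r

variable (K) in
theorem dense_locallyLipschitz : Dense {f : C(K, ℝ) | LocallyLipschitz f} := by
  have hsep : (locallyLipschitzSubalgebra K).SeparatesPoints := fun x y hxy =>
    ⟨fun z => dist z y,
      ⟨⟨fun z => dist z y, by fun_prop⟩, (LipschitzWith.dist_left y).locallyLipschitz, rfl⟩,
      by simpa using hxy⟩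
  have h := ContinuousMap.subalgebra_topologicalClosure_eq_top_of_separatesPoints _ hsep
  rw [dense_iff_closure_eq]
  exact congrArg (SetLike.coe) h

theorem isOpen_setOf_hasFineOpenCover_graph (d : ℝ) (ε : ℝ≥0∞) :
    IsOpen {f : C(K, ℝ) | HasFineOpenCover d ε (range fun x => (x, f x))} := by
  rw [Metric.isOpen_iff]
  rintro f ⟨t, hto, hft, htd, hsum⟩
  obtain ⟨δ, hδ, hsub⟩ := (isCompact_range
    (continuous_id.prodMk f.continuous)).exists_thickening_subset_open (isOpen_iUnion hto) hft
  refine ⟨δ, hδ, fun g hg => ⟨t, hto, ?_, htd, hsum⟩⟩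
  rintro _ ⟨x, rfl⟩
  refine hsub (mem_thickening_iff.2 ⟨(x, f x), mem_range_self x, ?_⟩)
  have hgf : dist (g x) (f x) < δ := (ContinuousMap.dist_apply_le_dist x).trans_lt hg
  simpa [Prod.dist_eq, hδ] using hgf

variable (K) in
theorem eventually_residual_dimH_graph_le :
    ∀ᶠ f : C(K, ℝ) in residual C(K, ℝ),
      dimH (range fun x => (x, f x)) ≤ dimH (univ : Set K) := by
  have key : ∀ᶠ f : C(K, ℝ) in residual C(K, ℝ), ∀ (q : ℚ) (n : ℕ),
      dimH (univ : Set K) < (Real.toNNReal q : ℝ≥0∞) →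
        HasFineOpenCover (Real.toNNReal q : ℝ) ((n : ℝ≥0∞) + 1)⁻¹ (range fun x => (x, f x)) := by
    simp only [eventually_countable_forall]
    intro q n hq
    refine residual_of_dense_open (isOpen_setOf_hasFineOpenCover_graph _ _)
      ((dense_locallyLipschitz K).mono fun f hf => ?_)
    exact hasFineOpenCover_of_dimH_lt (hf.dimH_graph_le.trans_lt hq)
      (ENNReal.inv_ne_zero.2 (by finiteness)) (by finiteness)
  filter_upwards [key] with f hf
  refine le_of_forall_gt_imp_ge_of_dense fun a ha => ?_
  obtain ⟨q, -, hq, hqa⟩ := ENNReal.lt_iff_exists_rat_btwn.1 ha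
  exact (dimH_le_of_forall_hasFineOpenCover fun n => hf q n hq).trans hqa.le

end Graph

/-- Let `K` be a compact metric space. Then for the generic `f ∈ C(K)` the
graph of `f` in `K × ℝ` has Hausdorff dimension equal to `dim_H K`. -/
theorem generic_graph_hausdorff_dimension
    {K : Type*} [MetricSpace K] [CompactSpace K] :
    {f : C(K, ℝ) | hdim (Set.range fun x => (x, f x)) = hdim (Set.univ : Set K)} ∈
      residual C(K, ℝ) := by
  filter_upwards [eventually_residual_dimH_graph_le K] with f hf
  have h := hf.antisymm (dimH_univ_le_dimH_graph f)
  simp [hdim, range_eq_empty_iff, univ_eq_empty_iff, h]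
end

section
/- Let C ⊆ K be compact metric spaces. Then for the generic f ∈ C(K) one has dim_H graph(f|_C) = dim_H C, where graph(f|_C) = {(x, f(x)) : x ∈ C} ⊆ K × ℝ. -/
open MeasureTheory Topology Metric Set
open scoped Classical

open scoped ENNReal NNReal

/-- A set of vanishing Hausdorff measure has countable open covers by sets of small diameter
with arbitrarily small Hausdorff sum. -/
theorem exists_isOpen_cover_of_hausdorffMeasure_eq_zero {X : Type*} [MetricSpace X]
    [MeasurableSpace X] [BorelSpace X] {s : Set X} {d : ℝ} (hd : 0 < d) (hs : μH[d] s = 0)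
    {ε : ℝ≥0∞} (hε : ε ≠ 0) (hε_top : ε ≠ ∞) :
    ∃ t : ℕ → Set X, (∀ n, IsOpen (t n)) ∧ s ⊆ ⋃ n, t n ∧ (∀ n, ediam (t n) ≤ ε) ∧
      ∑' n, ediam (t n) ^ d ≤ ε := by
  have hε2 : 0 < ε / 2 := ENNReal.half_pos hε
  have hlt : ⨅ (t : ℕ → Set X) (_ : s ⊆ ⋃ n, t n) (_ : ∀ n, ediam (t n) ≤ ε / 2),
      ∑' n, ⨆ _ : (t n).Nonempty, ediam (t n) ^ d < ε / 2 := by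
    refine lt_of_le_of_lt ?_ hε2
    rw [← hs, Measure.hausdorffMeasure_apply]
    exact le_iSup₂ (f := fun (r : ℝ≥0∞) (_ : 0 < r) =>
      ⨅ (t : ℕ → Set X) (_ : s ⊆ ⋃ n, t n) (_ : ∀ n, ediam (t n) ≤ r),
        ∑' n, ⨆ _ : (t n).Nonempty, ediam (t n) ^ d) (ε / 2) hε2
  simp only [iInf_lt_iff] at hlt
  obtain ⟨t, hst, ht, hsum⟩ := hlt
  have hsup : ∀ n, ⨆ _ : (t n).Nonempty, ediam (t n) ^ d = ediam (t n) ^ d := by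
    intro n
    rcases (t n).eq_empty_or_nonempty with h | h
    · simp [h, hd]
    · simp [h]
  simp only [hsup] at hsum
  obtain ⟨η, hη, hηsum⟩ := ENNReal.exists_pos_sum_of_countable' hε2.ne' ℕ
  have key : ∀ n, ∃ δ : ℝ≥0, 0 < δ ∧ ediam (t n) + 2 * δ < ε ∧
      (ediam (t n) + 2 * δ) ^ d < ediam (t n) ^ d + η n := by
    intro n
    have hlt : ediam (t n) < ε := (ht n).trans_lt (ENNReal.half_lt_self hε hε_top)
    have hadd : Continuous fun δ : ℝ≥0 => ediam (t n) + 2 * (δ : ℝ≥0∞) := by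
      have : Continuous fun δ : ℝ≥0 => ((2 * δ : ℝ≥0) : ℝ≥0∞) := by fun_prop
      simp only [ENNReal.coe_mul, ENNReal.coe_ofNat] at this
      exact continuous_const.add this
    have hpow : Continuous fun δ : ℝ≥0 => (ediam (t n) + 2 * (δ : ℝ≥0∞)) ^ d :=
      (ENNReal.continuous_rpow_const (y := d)).comp hadd
    have h₁ : ∀ᶠ δ : ℝ≥0 in 𝓝 0, ediam (t n) + 2 * (δ : ℝ≥0∞) < ε :=
      hadd.continuousAt.eventually_lt continuousAt_const (by simpa using hlt)
    have h₂ : ∀ᶠ δ : ℝ≥0 in 𝓝 0,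
        (ediam (t n) + 2 * (δ : ℝ≥0∞)) ^ d < ediam (t n) ^ d + η n := by
      refine hpow.continuousAt.eventually_lt continuousAt_const ?_
      simpa using ENNReal.lt_add_right
        (ENNReal.rpow_ne_top_of_nonneg hd.le hlt.ne_top) (hη n).ne'
    obtain ⟨δ, ⟨h₁, h₂⟩, hδ⟩ := (((h₁.and h₂).filter_mono nhdsWithin_le_nhds).and
      (self_mem_nhdsWithin : Ioi (0 : ℝ≥0) ∈ 𝓝[>] 0)).exists
    exact ⟨δ, hδ, h₁, h₂⟩
  choose δ hδ hδε hδη using key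
  refine ⟨fun n => thickening (δ n) (t n), fun n => isOpen_thickening, ?_, ?_, ?_⟩
  · exact hst.trans (iUnion_mono fun n => self_subset_thickening (by exact_mod_cast hδ n) _)
  · exact fun n => (ediam_thickening_le _).trans (hδε n).le
  · calc ∑' n, ediam (thickening (δ n) (t n)) ^ d
        ≤ ∑' n, (ediam (t n) ^ d + η n) := ENNReal.tsum_le_tsum fun n =>
          (ENNReal.rpow_le_rpow (ediam_thickening_le _) hd.le).trans (hδη n).le
      _ = ∑' n, ediam (t n) ^ d + ∑' n, η n := ENNReal.tsum_add
      _ ≤ ε / 2 + ε / 2 := add_le_add hsum.le hηsum.le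
      _ = ε := ENNReal.add_halves ε

/-- A set having, for every `n`, a countable cover by sets of diameter at most `1 / (n + 1)` with
Hausdorff sum at most `1 / (n + 1)` has vanishing Hausdorff measure. -/
theorem hausdorffMeasure_eq_zero_of_forall_exists_cover {X : Type*} [MetricSpace X]
    [MeasurableSpace X] [BorelSpace X] {s : Set X} {d : ℝ}
    (h : ∀ n : ℕ, ∃ t : ℕ → Set X, s ⊆ ⋃ i, t i ∧ (∀ i, ediam (t i) ≤ ((n : ℝ≥0∞) + 1)⁻¹) ∧
      ∑' i, ediam (t i) ^ d ≤ ((n : ℝ≥0∞) + 1)⁻¹) :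
    μH[d] s = 0 := by
  rw [Measure.hausdorffMeasure_apply, ← nonpos_iff_eq_zero]
  refine iSup₂_le fun r hr => le_of_forall_gt fun ε hε => ?_
  obtain ⟨n, hn⟩ := ENNReal.exists_inv_nat_lt (lt_min hr hε).ne'
  have hn' : ((n : ℝ≥0∞) + 1)⁻¹ < min r ε :=
    (ENNReal.inv_le_inv.2 le_self_add).trans_lt hn
  obtain ⟨t, hst, ht, hsum⟩ := h n
  simp only [iInf_lt_iff]
  refine ⟨t, hst, fun i => (ht i).trans (hn'.le.trans (min_le_left _ _)), ?_⟩
  refine lt_of_le_of_lt (ENNReal.tsum_le_tsum fun i => ?_)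
    (hsum.trans_lt (hn'.trans_le (min_le_right _ _)))
  exact iSup_le fun _ => le_rfl

/-- Lipschitz functions are dense among the continuous functions on a compact metric space. -/
theorem dense_setOf_lipschitzWith (K : Type*) [MetricSpace K] [CompactSpace K] :
    Dense {f : C(K, ℝ) | ∃ L, LipschitzWith L f} := by
  rw [dense_iff_closure_eq]
  refine ContinuousMap.sublattice_closure_eq_top _ ⟨0, 0, LipschitzWith.const 0⟩ ?_ ?_ ?_
  · rintro f ⟨A, hA⟩ g ⟨B, hB⟩
    exact ⟨max A B, hA.min hB⟩
  · rintro f ⟨A, hA⟩ g ⟨B, hB⟩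
    exact ⟨max A B, hA.max hB⟩
  · intro v x y
    set c := (v y - v x) / dist y x with hc
    have hL : LipschitzWith (Real.toNNReal |c|) fun z => v x + c * dist z x := by
      refine LipschitzWith.of_dist_le' fun a b => ?_
      rw [Real.dist_eq, add_sub_add_left_eq_sub, ← mul_sub, abs_mul]
      gcongr
      exact abs_dist_sub_le a b x
    refine ⟨⟨_, hL.continuous⟩, ⟨_, hL⟩, by simp, ?_⟩
    rcases eq_or_ne y x with rfl | hxy
    · simp
    · have := dist_ne_zero.2 hxy
      simp [hc, this]

/-- The continuous functions whose graph over a compact set lies in a given open set form an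
open set. -/
theorem isOpen_setOf_graph_image_subset {X Y : Type*} [TopologicalSpace X]
    [LocallyCompactSpace X] [TopologicalSpace Y] {C : Set X} (hC : IsCompact C)
    {U : Set (X × Y)} (hU : IsOpen U) :
    IsOpen {f : C(X, Y) | (fun x => (x, f x)) '' C ⊆ U} := by
  have hcont : Continuous fun f : C(X, Y) => (ContinuousMap.id X).prodMk f :=
    ContinuousMap.continuous_of_continuous_uncurry _ (by
      change Continuous fun p : C(X, Y) × X => (p.2, p.1 p.2)
      fun_prop)
  convert (ContinuousMap.isOpen_setOfPred_mapsTo hC hU).preimage hcont using 1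
  ext f
  simp [MapsTo, subset_def]

theorem dimH_le_dimH_graph_image {X Y : Type*} [MetricSpace X] [MetricSpace Y] (f : X → Y)
    (C : Set X) : dimH C ≤ dimH ((fun x => (x, f x)) '' C) := by
  simpa [image_image] using
    (LipschitzWith.prod_fst (α := X) (β := Y)).dimH_image_le ((fun x => (x, f x)) '' C)

theorem LipschitzWith.dimH_graph_image_le {X Y : Type*} [MetricSpace X] [MetricSpace Y]
    {f : X → Y} {L : ℝ≥0} (hf : LipschitzWith L f) (C : Set X) :
    dimH ((fun x => (x, f x)) '' C) ≤ dimH C :=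
  (LipschitzWith.id.prodMk hf).dimH_image_le C

theorem eventually_residual_dimH_graph_image_le {K : Type*} [MetricSpace K] [CompactSpace K]
    {C : Set K} (hC : IsCompact C) {d : ℝ≥0} (hd : dimH C < d) :
    ∀ᶠ f : C(K, ℝ) in residual C(K, ℝ), dimH ((fun x => (x, f x)) '' C) ≤ d := by
  borelize (K × ℝ)
  have hd0 : (0 : ℝ) < d := by exact_mod_cast pos_of_gt hd
  let G (n : ℕ) : Set C(K, ℝ) := ⋃ (t : ℕ → Set (K × ℝ)) (_ : ∀ i, IsOpen (t i))
    (_ : ∀ i, ediam (t i) ≤ ((n : ℝ≥0∞) + 1)⁻¹)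
    (_ : ∑' i, ediam (t i) ^ (d : ℝ) ≤ ((n : ℝ≥0∞) + 1)⁻¹),
    {f : C(K, ℝ) | (fun x => (x, f x)) '' C ⊆ ⋃ i, t i}
  have hG : ∀ n, G n ∈ residual C(K, ℝ) := by
    intro n
    refine residual_of_dense_open ?_ ?_
    · exact isOpen_iUnion fun t => isOpen_iUnion fun ht => isOpen_iUnion fun _ =>
        isOpen_iUnion fun _ => isOpen_setOf_graph_image_subset hC (isOpen_iUnion ht)
    · refine (dense_setOf_lipschitzWith K).mono ?_
      rintro f ⟨L, hL⟩
      obtain ⟨t, ht, hst, hdiam, hsum⟩ := exists_isOpen_cover_of_hausdorffMeasure_eq_zero hd0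
        (hausdorffMeasure_of_dimH_lt ((hL.dimH_graph_image_le C).trans_lt hd))
        (ε := ((n : ℝ≥0∞) + 1)⁻¹) (by simp) (by simp)
      simp only [G, mem_iUnion]
      exact ⟨t, ht, hdiam, hsum, hst⟩
  filter_upwards [eventually_countable_forall.2 hG] with f hf
  refine dimH_le_of_hausdorffMeasure_ne_top ?_
  rw [hausdorffMeasure_eq_zero_of_forall_exists_cover]
  · exact ENNReal.zero_ne_top
  · intro n
    have : f ∈ G n := hf n
    simp only [G, mem_iUnion] at this
    obtain ⟨t, -, hdiam, hsum, hst⟩ := this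
    exact ⟨t, hst, hdiam, hsum⟩

theorem eventually_residual_dimH_graph_image_eq {K : Type*} [MetricSpace K] [CompactSpace K]
    {C : Set K} (hC : IsCompact C) :
    ∀ᶠ f : C(K, ℝ) in residual C(K, ℝ), dimH ((fun x => (x, f x)) '' C) = dimH C := by
  have h : ∀ᶠ f : C(K, ℝ) in residual C(K, ℝ), ∀ q : ℚ, dimH C < (q : ℝ).toNNReal →
      dimH ((fun x => (x, f x)) '' C) ≤ (q : ℝ).toNNReal := by
    refine eventually_countable_forall.2 fun q => ?_
    by_cases hq : dimH C < (q : ℝ).toNNReal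
    · filter_upwards [eventually_residual_dimH_graph_image_le hC hq] with f hf _ using hf
    · exact Filter.Eventually.of_forall fun _ h => absurd h hq
  filter_upwards [h] with f hf
  refine le_antisymm (le_of_forall_gt fun b hb => ?_) (dimH_le_dimH_graph_image f C)
  obtain ⟨q, -, hCq, hqb⟩ := ENNReal.lt_iff_exists_rat_btwn.1 hb
  exact (hf q hCq).trans_lt hqb

/-- Let `C ⊆ K` be compact metric spaces. Then for the generic `f ∈ C(K)` the
graph of `f|_C`, i.e. `{(x, f(x)) : x ∈ C} ⊆ K × ℝ`, has Hausdorff dimension `dim_H C`. -/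
theorem generic_graph_restrict_hausdorff_dimension
    {K : Type*} [MetricSpace K] [CompactSpace K] (C : Set K) (hC : IsCompact C) :
    {f : C(K, ℝ) | hdim ((fun x => (x, f x)) '' C) = hdim C} ∈ residual C(K, ℝ) := by
  filter_upwards [eventually_residual_dimH_graph_image_eq hC] with f hf
  simp [hdim, hf]
end

section
/- Let K be a compact metric space that is not totally disconnected (equivalently, has positive topological dimension). Then for the generic f ∈ C(K): (i) dim_H f⁻¹(y) ≤ dim_tH K − 1 for every y ∈ ℝ, and (ii) for every d < dim_tH K there exists a non-degenerate interval I_{f,d} ⊆ ℝ such that dim_H f⁻¹(y) ≥ d − 1 for every y ∈ I_{f,d}. -/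
open MeasureTheory Topology Metric Set
open scoped Classical

open scoped ENNReal NNReal
open Filter (Tendsto)

/-- `s` has a countable open cover by sets of diameter at most `η` whose `q`-dimensional
Hausdorff sum is at most `η`. -/
def HasFineCover {X : Type*} [EMetricSpace X] (q : ℝ) (η : ℝ≥0∞) (s : Set X) : Prop :=
  ∃ t : ℕ → Set X, (∀ n, IsOpen (t n)) ∧ s ⊆ ⋃ n, t n ∧ (∀ n, ediam (t n) ≤ η) ∧
    ∑' n, ediam (t n) ^ q ≤ η

theorem HasFineCover.mono {X : Type*} [EMetricSpace X] {q : ℝ} {η : ℝ≥0∞} {s t : Set X}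
    (h : HasFineCover q η t) (hst : s ⊆ t) : HasFineCover q η s := by
  obtain ⟨u, hu, htu, h⟩ := h
  exact ⟨u, hu, hst.trans htu, h⟩

theorem hasFineCover_empty {X : Type*} [EMetricSpace X] {q : ℝ} (hq : 0 < q) (η : ℝ≥0∞) :
    HasFineCover q η (∅ : Set X) :=
  ⟨fun _ => ∅, fun _ => isOpen_empty, empty_subset _, by simp, by simp [hq]⟩

theorem exists_isOpen_superset_ediam_rpow_le_s17 {X : Type*} [EMetricSpace X] {q : ℝ} (hq : 0 < q)
    {η ε : ℝ≥0∞} (hε : ε ≠ 0) (s : Set X) (hs : ediam s < η) :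
    ∃ u, IsOpen u ∧ s ⊆ u ∧ ediam u ≤ η ∧ ediam u ^ q ≤ ediam s ^ q + ε := by
  have hs_top : ediam s ≠ ⊤ := (hs.trans_le le_top).ne
  have hlim : Tendsto (fun δ : ℝ≥0 => ediam s + 2 * (δ : ℝ≥0∞)) (𝓝 0) (𝓝 (ediam s)) := by
    have : Tendsto (fun δ : ℝ≥0 => ediam s + 2 * (δ : ℝ≥0∞)) (𝓝 0)
        (𝓝 (ediam s + 2 * ((0 : ℝ≥0) : ℝ≥0∞))) :=
      tendsto_const_nhds.add (ENNReal.Tendsto.const_mul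
        (ENNReal.continuous_coe.tendsto 0) (Or.inr (by simp)))
    simpa using this
  have hpow := (ENNReal.continuous_rpow_const (y := q)).continuousAt.tendsto.comp hlim
  have hlt : ediam s ^ q < ediam s ^ q + ε :=
    ENNReal.lt_add_right (ENNReal.rpow_ne_top_of_nonneg hq.le hs_top) hε
  have hev := (hlim.eventually_lt_const hs).and (hpow.eventually_lt_const hlt)
  obtain ⟨δ, ⟨h1, h2⟩, hδ⟩ := ((hev.filter_mono nhdsWithin_le_nhds).and
    (self_mem_nhdsWithin : Ioi (0 : ℝ≥0) ∈ 𝓝[>] 0)).exists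
  have hle := ediam_thickening_le (s := s) δ
  refine ⟨thickening δ s, isOpen_thickening, self_subset_thickening (by exact_mod_cast hδ) s,
    hle.trans h1.le, ?_⟩
  exact (ENNReal.rpow_le_rpow hle hq.le).trans h2.le

theorem hasFineCover_of_dimH_lt {X : Type*} [EMetricSpace X] {q : ℝ≥0} (hq : 0 < q)
    {η : ℝ≥0∞} (hη : η ≠ 0) (hη' : η ≠ ⊤) {s : Set X} (hs : dimH s < q) :
    HasFineCover q η s := by
  borelize X
  have h0 := hausdorffMeasure_of_dimH_lt hs
  rw [Measure.hausdorffMeasure_apply] at h0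
  have hη2 : 0 < η / 2 := ENNReal.half_pos hη
  have h1 : (⨅ (t : ℕ → Set X) (_ : s ⊆ ⋃ n, t n) (_ : ∀ n, ediam (t n) ≤ η / 2),
      ∑' n, ⨆ _ : (t n).Nonempty, ediam (t n) ^ (q : ℝ)) < η / 2 := by
    refine lt_of_le_of_lt ?_ hη2
    rw [← h0]
    exact le_iSup₂_of_le (η / 2) hη2 le_rfl
  simp only [iInf_lt_iff] at h1
  obtain ⟨t, hst, htd, hsum⟩ := h1
  obtain ⟨ε, hε, hεsum⟩ := ENNReal.exists_pos_sum_of_countable' hη2.ne' ℕ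
  have hlt : η / 2 < η := ENNReal.half_lt_self hη hη'
  choose u hu htu hud hup using fun n =>
    exists_isOpen_superset_ediam_rpow_le_s17 (q := q) (by exact_mod_cast hq) (hε n).ne' (t n)
      ((htd n).trans_lt hlt)
  refine ⟨u, hu, hst.trans (iUnion_mono htu), hud, ?_⟩
  have hne : ∀ n, (⨆ _ : (t n).Nonempty, ediam (t n) ^ (q : ℝ)) = ediam (t n) ^ (q : ℝ) := by
    intro n
    rcases (t n).eq_empty_or_nonempty with h | h
    · simp [h, hq]
    · simp [h]
  simp only [hne] at hsum
  calc ∑' n, ediam (u n) ^ (q : ℝ) ≤ ∑' n, (ediam (t n) ^ (q : ℝ) + ε n) :=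
        ENNReal.tsum_le_tsum hup
    _ = ∑' n, ediam (t n) ^ (q : ℝ) + ∑' n, ε n := ENNReal.tsum_add
    _ ≤ η / 2 + η / 2 := add_le_add hsum.le hεsum.le
    _ = η := ENNReal.add_halves η

theorem dimH_le_of_hasFineCover {X : Type*} [EMetricSpace X] {q : ℝ≥0} {s : Set X}
    (h : ∀ n : ℕ, HasFineCover q ((n : ℝ≥0∞) + 1)⁻¹ s) : dimH s ≤ q := by
  borelize X
  choose t _ hst htd hsum using h
  have hlim : Tendsto (fun n : ℕ => ((n : ℝ≥0∞) + 1)⁻¹) Filter.atTop (𝓝 0) := by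
    have := (Filter.tendsto_add_atTop_iff_nat 1).2 ENNReal.tendsto_inv_nat_nhds_zero
    simpa using this
  have hle := Measure.hausdorffMeasure_le_liminf_tsum (q : ℝ) s _ hlim t
    (.of_forall htd) (.of_forall hst)
  refine dimH_le_of_hausdorffMeasure_ne_top (ne_top_of_le_ne_top ENNReal.zero_ne_top
    (hle.trans ?_))
  rw [← hlim.liminf_eq]
  exact Filter.liminf_le_liminf (.of_forall hsum)

theorem HasFineCover.union_isOpen {X : Type*} [EMetricSpace X] {q : ℝ} {η : ℝ≥0∞} {s u : Set X}
    (h : HasFineCover q (η / 2) s) (hu : IsOpen u) (hud : ediam u ≤ η)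
    (hup : ediam u ^ q ≤ η / 2) : HasFineCover q η (u ∪ s) := by
  obtain ⟨t, ht, hst, htd, hsum⟩ := h
  refine ⟨fun n => n.casesOn u t, ?_, ?_, ?_, ?_⟩
  · rintro (_ | n)
    exacts [hu, ht n]
  · rintro x (hx | hx)
    · exact mem_iUnion.2 ⟨0, hx⟩
    · obtain ⟨n, hn⟩ := mem_iUnion.1 (hst hx)
      exact mem_iUnion.2 ⟨n + 1, hn⟩
  · rintro (_ | n)
    exacts [hud, (htd n).trans ENNReal.half_le_self]
  · rw [tsum_eq_zero_add' ENNReal.summable]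
    calc ediam u ^ q + ∑' n, ediam (t n) ^ q ≤ η / 2 + η / 2 := add_le_add hup hsum
      _ = η := ENNReal.add_halves η

theorem exists_injective_abs_sub_lt {ι : Type*} [Finite ι] (a : ι → ℝ) {ε : ℝ} (hε : 0 < ε) :
    ∃ c : ι → ℝ, Function.Injective c ∧ ∀ i, |c i - a i| < ε := by
  obtain ⟨n, ⟨e⟩⟩ := Finite.exists_equiv_fin ι
  have hn : (0 : ℝ) < n + 1 := by positivity
  have hfin : (range fun p : ι × ι => (a p.2 - a p.1) / ((e p.1 : ℝ) - e p.2)).Finite :=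
    finite_range _
  obtain ⟨τ, ⟨hτ0, hτ⟩, hτn⟩ :=
    (Ioo_infinite (div_pos hε hn)).exists_notMem_finite hfin
  refine ⟨fun i => a i + τ * e i, fun i j hij => ?_, fun i => ?_⟩
  · by_contra hne
    apply hτn
    have hne' : ((e i : ℝ) - e j) ≠ 0 := by
      rw [sub_ne_zero]
      intro h
      exact hne (e.injective (Fin.ext (by exact_mod_cast h)))
    refine ⟨(i, j), ?_⟩
    simp only at hij ⊢
    rw [div_eq_iff hne']
    linarith
  · have hei : ((e i : ℕ) : ℝ) ≤ n := by exact_mod_cast (e i).2.le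
    rw [add_sub_cancel_left, abs_of_nonneg (by positivity)]
    rw [lt_div_iff₀ hn] at hτ
    nlinarith

theorem isOpen_setOf_forall_hasFineCover_preimage {K : Type*} [MetricSpace K] [CompactSpace K]
    {q : ℝ} (hq : 0 < q) (η : ℝ≥0∞) :
    IsOpen {f : C(K, ℝ) | ∀ y : ℝ, HasFineCover q η (f ⁻¹' {y})} := by
  rw [Metric.isOpen_iff]
  intro f hf
  choose t ht hft htd hsum using hf
  have hV : ∀ y, IsOpen (⋃ n, t y n) := fun y => isOpen_iUnion (ht y)
  have hW : ∀ y, IsOpen (f '' (⋃ n, t y n)ᶜ)ᶜ := fun y =>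
    ((hV y).isClosed_compl.isCompact.image f.continuous).isClosed.isOpen_compl
  obtain ⟨δ, hδ, hleb⟩ := lebesgue_number_lemma_of_metric (isCompact_range f.continuous) hW
    (fun y _ => mem_iUnion.2 ⟨y, by
      rintro ⟨x, hx, hxy⟩
      exact hx (hft y hxy)⟩)
  refine ⟨δ / 2, half_pos hδ, fun g hg z => ?_⟩
  have hgf : ∀ x, dist (g x) (f x) < δ / 2 := (ContinuousMap.dist_lt_iff (half_pos hδ)).1 hg
  rcases (g ⁻¹' {z}).eq_empty_or_nonempty with h | ⟨x, hx⟩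
  · rw [h]
    exact hasFineCover_empty hq η
  obtain ⟨y, hy⟩ := hleb (f x) (mem_range_self x)
  refine ⟨t y, ht y, fun x' hx' => ?_, htd y, hsum y⟩
  have hmem : f x' ∈ ball (f x) δ := by
    rw [mem_ball]
    have h1 := hgf x
    have h2 := hgf x'
    rw [show g x = z from hx] at h1
    rw [show g x' = z from hx', dist_comm] at h2
    linarith [dist_triangle (f x') z (f x)]
  by_contra hx''
  exact hy hmem ⟨x', hx'', rfl⟩

theorem exists_ball_ediam_small {q : ℝ} (hq : 0 < q) {η : ℝ≥0∞} (hη : η ≠ 0) {δ : ℝ}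
    (hδ : 0 < δ) : ∃ r : ℝ, 0 < r ∧ r < δ ∧ 2 * ENNReal.ofReal r ≤ η ∧
      (2 * ENNReal.ofReal r) ^ q ≤ η := by
  have hlim : Tendsto (fun r : ℝ => 2 * ENNReal.ofReal r) (𝓝 0) (𝓝 0) := by
    have : Tendsto (fun r : ℝ => 2 * ENNReal.ofReal r) (𝓝 0) (𝓝 (2 * ENNReal.ofReal 0)) :=
      ENNReal.Tendsto.const_mul (ENNReal.continuous_ofReal.tendsto 0) (Or.inr (by simp))
    simpa using this
  have hpow := (ENNReal.continuous_rpow_const (y := q)).continuousAt.tendsto.comp hlim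
  rw [ENNReal.zero_rpow_of_pos hq] at hpow
  have hη0 : 0 < η := pos_iff_ne_zero.2 hη
  have hev := (hlim.eventually_lt_const hη0).and
    ((hpow.eventually_lt_const hη0).and (eventually_lt_nhds hδ))
  obtain ⟨r, ⟨h1, h2, h3⟩, hr⟩ := ((hev.filter_mono nhdsWithin_le_nhds).and
    (self_mem_nhdsWithin : Ioi (0 : ℝ) ∈ 𝓝[>] 0)).exists
  exact ⟨r, hr, h3, h1.le, h2.le⟩

theorem dense_setOf_forall_hasFineCover_preimage {K : Type*} [MetricSpace K] [CompactSpace K]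
    {q : ℝ≥0} (hq : 0 < q) {η : ℝ≥0∞} (hη : η ≠ 0) (hη' : η ≠ ⊤) {𝒰 : Set (Set K)}
    (h𝒰 : TopologicalSpace.IsTopologicalBasis 𝒰) (hdim : ∀ U ∈ 𝒰, dimH (frontier U) < q) :
    Dense {f : C(K, ℝ) | ∀ y : ℝ, HasFineCover q η (f ⁻¹' {y})} := by
  rw [Metric.dense_iff]
  intro f ε hε
  have hq' : (0 : ℝ) < q := by exact_mod_cast hq
  have hη2 : η / 2 ≠ 0 := (ENNReal.half_pos hη).ne'
  have hη2' : η / 2 ≠ ⊤ := (ENNReal.half_lt_self hη hη').ne_top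
  obtain ⟨δ, hδ, hfδ⟩ := Metric.uniformContinuous_iff.1
    (CompactSpace.uniformContinuous_of_continuous f.continuous) (ε / 4) (by positivity)
  obtain ⟨r, hr, hrδ, hrη, hrq⟩ := exists_ball_ediam_small hq' hη2 hδ
  choose U hU𝒰 hxU hUball using fun x : K =>
    h𝒰.exists_subset_of_mem_open (mem_ball_self hr : x ∈ ball x r) isOpen_ball
  have hUo : ∀ x, IsOpen (U x) := fun x => h𝒰.isOpen (hU𝒰 x)
  obtain ⟨T, -, hT⟩ := isCompact_univ.elim_nhds_subcover U
    fun x _ => (hUo x).mem_nhds (hxU x)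
  have hcov : HasFineCover q (η / 2) (⋃ p : T, frontier (U p)) := by
    refine hasFineCover_of_dimH_lt hq hη2 hη2' ?_
    rw [dimH_iUnion]
    refine (iSup_lt_iff.2 ?_)
    refine ⟨Finset.univ.sup fun p : T => dimH (frontier (U p)), ?_, fun p =>
      Finset.le_sup (f := fun p : T => dimH (frontier (U p))) (Finset.mem_univ p)⟩
    exact (Finset.sup_lt_iff (by simpa using hq)).2 fun p _ => hdim _ (hU𝒰 p)
  obtain ⟨t, ht, hFt, htd, hsum⟩ := hcov
  set V := ⋃ n, t n with hVdef
  have hVo : IsOpen V := isOpen_iUnion ht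
  have hVcov : HasFineCover q (η / 2) V := ⟨t, ht, subset_rfl, htd, hsum⟩
  -- the signature of a point records which sets of the finite subcover contain it
  let σ : K → Set T := fun x => {p | x ∈ U p}
  have hσ : ∀ x, ∃ p : T, p ∈ σ x := fun x => by
    obtain ⟨p, hp, hx⟩ := mem_iUnion₂.1 (hT (mem_univ x))
    exact ⟨⟨p, hp⟩, hx⟩
  let a : Set T → ℝ := fun S => if h : S.Nonempty then f (h.some : K) else 0
  have hnear : ∀ x, ∀ p : T, p ∈ σ x → |f p - f x| < ε / 4 := fun x p hp => by
    have : dist x (p : K) < r := hUball p hp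
    have h := hfδ ((dist_comm (p : K) x).trans_lt (this.trans hrδ))
    rwa [Real.dist_eq] at h
  have ha : ∀ x, |a (σ x) - f x| < ε / 4 := fun x => by
    have hne : (σ x).Nonempty := hσ x
    simp only [a, dif_pos hne]
    exact hnear x _ hne.some_mem
  obtain ⟨c, hc, hca⟩ := exists_injective_abs_sub_lt a (show 0 < ε / 4 by positivity)
  have hσc : ∀ x ∉ V, ∀ᶠ x' in 𝓝 x, σ x' = σ x := by
    intro x hx
    have h1 : ∀ p : T, ∀ᶠ x' in 𝓝 x, (x' ∈ U p ↔ x ∈ U p) := by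
      intro p
      by_cases hxp : x ∈ U p
      · filter_upwards [(hUo p).mem_nhds hxp] with x' hx'
        simp [hx', hxp]
      · have hcl : x ∉ closure (U p) := fun h => hx <| hFt <| mem_iUnion.2
          ⟨p, by rw [(hUo p).frontier_eq]; exact ⟨h, hxp⟩⟩
        filter_upwards [isClosed_closure.isOpen_compl.mem_nhds hcl] with x' hx'
        simp only [hxp, iff_false]
        exact fun h => hx' (subset_closure h)
    filter_upwards [Filter.eventually_all.2 h1] with x' hx'
    ext p
    exact hx' p
  have hcont : Continuous fun x : (Vᶜ : Set K) => c (σ x) - f x := by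
    refine Continuous.sub ?_ (f.continuous.comp continuous_subtype_val)
    rw [continuous_iff_continuousAt]
    intro x
    have hev : ∀ᶠ x' : (Vᶜ : Set K) in 𝓝 x, c (σ x') = c (σ x) :=
      (continuous_subtype_val.continuousAt.eventually (hσc x x.2)).mono
        fun x' hx' => by rw [hx']
    exact (continuousAt_const (y := c (σ x))).congr (hev.mono fun _ h => h.symm)
  obtain ⟨h, hhmem, hheq⟩ := ContinuousMap.exists_restrict_eq_forall_mem_of_closed
    (⟨_, hcont⟩ : C((Vᶜ : Set K), ℝ)) (t := Icc (-(ε / 2)) (ε / 2))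
    (fun x => by
      have h1 := abs_lt.1 (hca (σ x))
      have h2 := abs_lt.1 (ha x)
      simp only [ContinuousMap.coe_mk, mem_Icc]
      constructor <;> linarith [h1.1, h1.2, h2.1, h2.2])
    ⟨0, by constructor <;> linarith⟩ hVo.isClosed_compl
  have hval : ∀ x ∉ V, f x + h x = c (σ x) := fun x hx => by
    have := DFunLike.congr_fun hheq (⟨x, hx⟩ : (Vᶜ : Set K))
    simp only [ContinuousMap.restrict_apply, ContinuousMap.coe_mk] at this
    rw [this]
    ring
  refine ⟨f + h, ?_, fun y => ?_⟩
  · rw [mem_ball, ContinuousMap.dist_lt_iff hε]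
    intro x
    have := hhmem x
    rw [ContinuousMap.add_apply, Real.dist_eq, add_sub_cancel_left, abs_lt]
    constructor <;> linarith [this.1, this.2]
  · by_cases hy : ∃ x ∉ V, f x + h x = y
    · obtain ⟨x, hx, hxy⟩ := hy
      obtain ⟨p, hp⟩ := hσ x
      have hUd : ediam (U p) ≤ 2 * ENNReal.ofReal r := by
        refine (ediam_mono (hUball p)).trans ?_
        rw [← Metric.eball_ofReal]
        exact Metric.ediam_eball_le
      refine (hVcov.union_isOpen (hUo p) (hUd.trans (hrη.trans ENNReal.half_le_self))
        ((ENNReal.rpow_le_rpow hUd hq'.le).trans hrq)).mono fun x' hx' => ?_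
      by_cases hx'V : x' ∈ V
      · exact Or.inr hx'V
      · left
        have hx'y : f x' + h x' = y := hx'
        have : σ x' = σ x := hc (by rw [← hval x' hx'V, ← hval x hx, hx'y, hxy])
        have hp' : p ∈ σ x' := this ▸ hp
        exact hp'
    · push Not at hy
      refine HasFineCover.mono (t := ∅ ∪ V) (hVcov.union_isOpen isOpen_empty (by simp)
        (by simp [hq])) fun x hx => Or.inr ?_
      by_contra hxV
      exact hy x hxV hx

theorem residual_forall_dimH_preimage_le {K : Type*} [MetricSpace K] [CompactSpace K]
    {q : ℝ≥0} (hq : 0 < q) {𝒰 : Set (Set K)}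
    (h𝒰 : TopologicalSpace.IsTopologicalBasis 𝒰) (hdim : ∀ U ∈ 𝒰, dimH (frontier U) < q) :
    ∀ᶠ f : C(K, ℝ) in residual C(K, ℝ), ∀ y : ℝ, dimH (f ⁻¹' {y}) ≤ q := by
  have h : ∀ᶠ f : C(K, ℝ) in residual C(K, ℝ), ∀ n : ℕ, ∀ y : ℝ,
      HasFineCover q ((n : ℝ≥0∞) + 1)⁻¹ (f ⁻¹' {y}) :=
    eventually_countable_forall.2 fun n => residual_of_dense_open
      (isOpen_setOf_forall_hasFineCover_preimage (by exact_mod_cast hq) _)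
      (dense_setOf_forall_hasFineCover_preimage hq (by simp) (by simp) h𝒰 hdim)
  filter_upwards [h] with f hf y
  exact dimH_le_of_hasFineCover fun n => hf n y

theorem hdim_mono {X : Type*} [EMetricSpace X] {s t : Set X} (h : s ⊆ t) : hdim s ≤ hdim t := by
  unfold hdim
  split_ifs with hs ht ht
  · exact le_rfl
  · exact le_trans (by simp) (EReal.coe_ennreal_nonneg _)
  · exact absurd (subset_eq_empty h ht) hs
  · exact EReal.coe_ennreal_le_coe_ennreal_iff.2 (dimH_mono h)

theorem dimH_lt_of_hdim_lt {X : Type*} [EMetricSpace X] {s : Set X} {q : ℝ≥0} (hq : 0 < q)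
    (h : hdim s < (q : ℝ)) : dimH s < q := by
  unfold hdim at h
  split_ifs at h with hs
  · simpa [hs] using hq
  · exact EReal.coe_ennreal_lt_coe_ennreal_iff.1 h

theorem hdim_le_of_dimH_le {X : Type*} [EMetricSpace X] {s : Set X} {q : ℝ≥0}
    (h : dimH s ≤ q) : hdim s ≤ (q : ℝ) := by
  unfold hdim
  split_ifs with hs
  · exact le_trans (by simp) (EReal.coe_nonneg.2 q.2)
  · exact EReal.coe_ennreal_le_coe_ennreal_iff.2 h

theorem eq_empty_of_hdim_neg {X : Type*} [EMetricSpace X] {s : Set X} (h : hdim s < 0) :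
    s = ∅ := by
  unfold hdim at h
  split_ifs at h with hs
  · exact hs
  · exact absurd h (EReal.coe_ennreal_nonneg _).not_gt

theorem totallyDisconnectedSpace_of_isTopologicalBasis_isClopen {X : Type*} [TopologicalSpace X]
    [T0Space X] {𝒰 : Set (Set X)} (h𝒰 : TopologicalSpace.IsTopologicalBasis 𝒰)
    (h : ∀ U ∈ 𝒰, IsClopen U) : TotallyDisconnectedSpace X := by
  have : TotallySeparatedSpace X := totallySeparatedSpace_of_t0_of_basis_clopen
    (h𝒰.of_isOpen_of_subset (fun _ h => h.isOpen) h)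
  infer_instance

theorem residual_forall_hdim_preimage_le {K : Type*} [MetricSpace K] [CompactSpace K]
    (hK : ¬ TotallyDisconnectedSpace K) :
    ∀ᶠ f : C(K, ℝ) in residual C(K, ℝ), ∀ y : ℝ, hdim (f ⁻¹' {y}) ≤ tHdim K - 1 := by
  have hne : Nonempty K := by
    by_contra h
    rw [not_nonempty_iff] at h
    exact hK inferInstance
  have h : ∀ᶠ f : C(K, ℝ) in residual C(K, ℝ), ∀ q : ℚ, tHdim K - 1 < ((q : ℝ) : EReal) →
      ∀ y : ℝ, hdim (f ⁻¹' {y}) ≤ ((q : ℝ) : EReal) := by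
    refine eventually_countable_forall.2 fun q => ?_
    by_cases hq : tHdim K - 1 < ((q : ℝ) : EReal)
    swap
    · exact .of_forall fun f h => absurd h hq
    have hlt : tHdim K < ((q : ℝ) : EReal) + 1 :=
      (EReal.sub_lt_iff (Or.inl (EReal.coe_ne_bot 1)) (Or.inl (EReal.coe_ne_top 1))).1 hq
    rw [tHdim, if_pos hne, sInf_lt_iff] at hlt
    obtain ⟨d, ⟨𝒰, h𝒰, hd⟩, hdq⟩ := hlt
    have hd1 : d - 1 < ((q : ℝ) : EReal) :=
      (EReal.sub_lt_iff (Or.inl (EReal.coe_ne_bot 1)) (Or.inl (EReal.coe_ne_top 1))).2 hdq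
    have hfr : ∀ U ∈ 𝒰, hdim (frontier U) < ((q : ℝ) : EReal) := fun U hU =>
      (hd U hU).trans_lt hd1
    have hq0 : (0 : ℝ) < q := by
      by_contra hle
      have hle' : ((q : ℝ) : EReal) ≤ 0 := by exact_mod_cast not_lt.1 hle
      exact hK (totallyDisconnectedSpace_of_isTopologicalBasis_isClopen h𝒰 fun U hU =>
        isClopen_iff_frontier_eq_empty.2 (eq_empty_of_hdim_neg ((hfr U hU).trans_le hle')))
    lift (q : ℝ) to ℝ≥0 using hq0.le with p
    have hp : 0 < p := by exact_mod_cast hq0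
    filter_upwards [residual_forall_dimH_preimage_le hp h𝒰
      fun U hU => dimH_lt_of_hdim_lt hp (hfr U hU)] with f hf _ y
    exact hdim_le_of_dimH_le (hf y)
  filter_upwards [h] with f hf y
  by_contra! hlt
  obtain ⟨q, h1, h2⟩ := EReal.lt_iff_exists_rat_btwn.1 hlt
  exact (hf q h1 y).not_gt h2

theorem exists_forall_lt_hdim_frontier {K : Type*} [MetricSpace K] {d : ℝ}
    (hd : (d : EReal) < tHdim K) (hne : Nonempty K) :
    ∃ (x : K) (W : Set K), x ∈ W ∧ IsOpen W ∧
      ∀ U, IsOpen U → x ∈ U → U ⊆ W → (d : EReal) - 1 < hdim (frontier U) := by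
  by_contra! h
  refine hd.not_ge ?_
  rw [tHdim, if_pos hne]
  refine sInf_le ⟨{U | IsOpen U ∧ hdim (frontier U) ≤ (d : EReal) - 1}, ?_, fun U hU => hU.2⟩
  refine TopologicalSpace.isTopologicalBasis_of_isOpen_of_nhds (fun U hU => hU.1) ?_
  intro x W hx hW
  obtain ⟨U, hU, hxU, hUW, hle⟩ := h x W hx hW
  exact ⟨U, ⟨hU, hle⟩, hxU, hUW⟩

theorem frontier_ball_inter_lt_subset {X : Type*} [PseudoMetricSpace X] {f : X → ℝ}
    (hf : Continuous f) {x : X} {r y : ℝ} (h : ∀ z ∈ sphere x r, y < f z) :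
    frontier (ball x r ∩ {z | f z < y}) ⊆ f ⁻¹' {y} := by
  intro z hz
  have hopen : IsOpen (ball x r ∩ {z | f z < y}) :=
    isOpen_ball.inter (isOpen_lt hf continuous_const)
  rw [hopen.frontier_eq] at hz
  have h1 : z ∈ closedBall x r :=
    closure_ball_subset_closedBall (closure_mono inter_subset_left hz.1)
  have h2 : f z ≤ y :=
    closure_lt_subset_le hf continuous_const (closure_mono inter_subset_right hz.1)
  refine h2.eq_or_lt.resolve_right fun hlt => ?_
  rcases (mem_closedBall.1 h1).eq_or_lt with he | hl
  · exact (h z he).not_gt hlt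
  · exact hz.2 ⟨hl, hlt⟩

theorem residual_exists_lt_of_mem_nhds {K : Type*} [MetricSpace K] [CompactSpace K] {x : K}
    {W : Set K} (hxW : W ∈ 𝓝 x) :
    ∀ᶠ f : C(K, ℝ) in residual C(K, ℝ), ∃ r > 0, ∃ a b : ℝ, ball x r ⊆ W ∧ a < b ∧
      f x < a ∧ ∀ z ∈ sphere x r, b < f z := by
  refine residual_of_dense_open ?_ ?_
  · refine isOpen_iff_mem_nhds.2 fun f ⟨r, hr, a, b, hW, hab, ha, hb⟩ => ?_
    have h1 : ∀ᶠ g : C(K, ℝ) in 𝓝 f, g x < a :=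
      (ContinuousEvalConst.continuous_eval_const x).continuousAt.eventually_lt_const ha
    have h2 : ∀ᶠ g : C(K, ℝ) in 𝓝 f, MapsTo g (sphere x r) (Ioi b) :=
      ContinuousMap.eventually_mapsTo (isCompact_sphere x r) isOpen_Ioi hb
    filter_upwards [h1, h2] with g hg1 hg2
    exact ⟨r, hr, a, b, hW, hab, hg1, hg2⟩
  · rw [Metric.dense_iff]
    intro f ε hε
    have hev : ∀ᶠ z in 𝓝 x, z ∈ W ∧ dist (f z) (f x) < ε / 8 :=
      Filter.Eventually.and hxW
        (Metric.tendsto_nhds.1 f.continuous.continuousAt (ε / 8) (by positivity))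
    obtain ⟨δ, hδ, hball⟩ := Metric.eventually_nhds_iff_ball.1 hev
    let φ : C(K, ℝ) := ⟨fun z => ε / 2 * max 0 (1 - dist z x / (δ / 2)), by fun_prop⟩
    have hφ0 : φ x = ε / 2 := by simp [φ]
    have hφs : ∀ z ∈ sphere x (δ / 2), φ z = 0 := fun z hz => by
      simp [φ, mem_sphere.1 hz, hδ.ne']
    have hφ : ∀ z, 0 ≤ φ z ∧ φ z ≤ ε / 2 := fun z => by
      have h1 : max 0 (1 - dist z x / (δ / 2)) ≤ 1 :=
        max_le zero_le_one (sub_le_self _ (by positivity))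
      have h0 : 0 ≤ max 0 (1 - dist z x / (δ / 2)) := le_max_left _ _
      simp only [φ, ContinuousMap.coe_mk]
      constructor
      · positivity
      · nlinarith
    refine ⟨f - φ, ?_, δ / 2, half_pos hδ, f x - ε / 4, f x - ε / 8, ?_, by linarith, ?_, ?_⟩
    · rw [mem_ball, ContinuousMap.dist_lt_iff hε]
      intro z
      rw [ContinuousMap.sub_apply, Real.dist_eq, abs_lt]
      constructor <;> linarith [(hφ z).1, (hφ z).2]
    · exact fun z hz => (hball z (ball_subset_ball (half_le_self hδ.le) hz)).1
    · rw [ContinuousMap.sub_apply, hφ0]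
      linarith
    · intro z hz
      have hz' : z ∈ ball x δ := by
        rw [mem_ball, mem_sphere.1 hz]
        exact half_lt_self hδ
      have := (hball z hz').2
      rw [Real.dist_eq, abs_lt] at this
      rw [ContinuousMap.sub_apply, hφs z hz]
      linarith [this.1]

theorem residual_exists_Icc_le_hdim_preimage {K : Type*} [MetricSpace K] [CompactSpace K]
    (hne : Nonempty K) {d : ℝ} (hd : (d : EReal) < tHdim K) :
    ∀ᶠ f : C(K, ℝ) in residual C(K, ℝ), ∃ a b : ℝ, a < b ∧
      ∀ y ∈ Icc a b, (d : EReal) - 1 ≤ hdim (f ⁻¹' {y}) := by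
  obtain ⟨x, W, hxW, hW, hdim⟩ := exists_forall_lt_hdim_frontier hd hne
  filter_upwards [residual_exists_lt_of_mem_nhds (hW.mem_nhds hxW)] with f hf
  obtain ⟨r, hr, a, b, hrW, hab, ha, hb⟩ := hf
  refine ⟨a, b, hab, fun y hy => ?_⟩
  refine (hdim (ball x r ∩ {z | f z < y})
    (isOpen_ball.inter (isOpen_lt f.continuous continuous_const))
    ⟨mem_ball_self hr, ha.trans_le hy.1⟩ (inter_subset_left.trans hrW)).le.trans ?_
  exact hdim_mono (frontier_ball_inter_lt_subset f.continuous
    fun z hz => hy.2.trans_lt (hb z hz))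

/-- Let `K` be a compact metric space which is not totally disconnected. Then
for the generic `f ∈ C(K)`: (i) `dim_H f⁻¹(y) ≤ dim_tH K − 1` for every `y ∈ ℝ`, and (ii) for
every real `d < dim_tH K` there is a non-degenerate interval `I ⊆ ℝ` such that
`dim_H f⁻¹(y) ≥ d − 1` for every `y ∈ I`. -/
theorem generic_level_set_bounds
    {K : Type*} [MetricSpace K] [CompactSpace K] (hK : ¬ TotallyDisconnectedSpace K) :
    {f : C(K, ℝ) | (∀ y : ℝ, hdim (⇑f ⁻¹' {y}) ≤ tHdim K - 1) ∧
        ∀ d : ℝ, (d : EReal) < tHdim K → ∃ a b : ℝ, a < b ∧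
          ∀ y ∈ Set.Icc a b, (d : EReal) - 1 ≤ hdim (⇑f ⁻¹' {y})} ∈ residual C(K, ℝ) := by
  have hne : Nonempty K := by
    by_contra h
    rw [not_nonempty_iff] at h
    exact hK inferInstance
  have h : ∀ᶠ f : C(K, ℝ) in residual C(K, ℝ), ∀ q : ℚ, ((q : ℝ) : EReal) < tHdim K →
      ∃ a b : ℝ, a < b ∧ ∀ y ∈ Icc a b, ((q : ℝ) : EReal) - 1 ≤ hdim (f ⁻¹' {y}) := by
    refine eventually_countable_forall.2 fun q => ?_
    by_cases hq : ((q : ℝ) : EReal) < tHdim K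
    · filter_upwards [residual_exists_Icc_le_hdim_preimage hne hq] with f hf _ using hf
    · exact .of_forall fun f h => absurd h hq
  filter_upwards [residual_forall_hdim_preimage_le hK, h] with f hf1 hf2
  refine ⟨hf1, fun d hd => ?_⟩
  obtain ⟨q, hdq, hq⟩ := EReal.lt_iff_exists_rat_btwn.1 hd
  obtain ⟨a, b, hab, hy⟩ := hf2 q hq
  exact ⟨a, b, hab, fun y hyI => (EReal.sub_le_sub hdq.le le_rfl).trans (hy y hyI)⟩
end
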